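/- The tricorn is not locally connected: the set T = {c ∈ ℂ : the orbit of 0 under the anti-holomorphic map A_c(z) = (z̄)² + c is bounded}, equipped with its subspace topology in ℂ, is not a locally connected topological space. -/

import Mathlib

/-! ### Part 1 : rigorous integer ball arithmetic -/

noncomputable section

namespace Tri

/-- forcing evaluation of a natural number -/
def fN {α : Type} (n : ℕ) (k : ℕ → α) : α := Nat.rec (k 0) (fun m _ => k (m+1)) n

def fI {α : Type} (z : ℤ) (k : ℤ → α) : α :=
  Int.rec (fun n => fN n (fun n => k (Int.ofNat n))) (fun n => fN n (fun n => k (Int.negSucc n))) z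

theorem fN_eq {α : Type} (n : ℕ) (k : ℕ → α) : fN n k = k n := by cases n <;> rfl
theorem fI_eq {α : Type} (z : ℤ) (k : ℤ → α) : fI z k = k z := by
  cases z with
  | ofNat n => exact fN_eq n (fun n => k (Int.ofNat n))
  | negSucc n => exact fN_eq n (fun n => k (Int.negSucc n))

/-- upper bound for the norm of an integer vector -/
def nb (a b : ℤ) : ℤ :=
  fN (Int.natAbs a) fun A => fN (Int.natAbs b) fun B =>
  fN (A*A+B*B) fun q => fN (A+B+1) fun m => fN ((m+q/m)/2) fun m =>
  fN ((m+q/m)/2+1) fun N => bif Nat.ble q (N*N) then Int.ofNat N else Int.ofNat (A+B)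

theorem nb_nonneg (a b : ℤ) : 0 ≤ nb a b := by
  simp only [nb, fN_eq]
  cases Nat.ble _ _ <;> exact Int.natCast_nonneg _

theorem nb_sq (a b : ℤ) : a^2+b^2 ≤ (nb a b)^2 := by
  simp only [nb, fN_eq]
  have ha : (a.natAbs : ℤ)*a.natAbs = a*a := Int.natAbs_mul_self
  have hb : (b.natAbs : ℤ)*b.natAbs = b*b := Int.natAbs_mul_self
  generalize ((a.natAbs+b.natAbs+1 + (a.natAbs * a.natAbs + b.natAbs * b.natAbs) / (a.natAbs+b.natAbs+1))/2) = m
  generalize ((m + (a.natAbs * a.natAbs + b.natAbs * b.natAbs) / m)/2+1) = N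
  cases h : Nat.ble (a.natAbs * a.natAbs + b.natAbs * b.natAbs) (N*N) with
  | true =>
    have h2 := Nat.le_of_ble_eq_true h
    have h3 : ((a.natAbs * a.natAbs + b.natAbs * b.natAbs : ℕ):ℤ) ≤ ((N*N : ℕ):ℤ) := by exact_mod_cast h2
    rw [Nat.cast_add, Nat.cast_mul, Nat.cast_mul, ha, hb, Nat.cast_mul] at h3
    simp only [cond_true, Int.ofNat_eq_natCast]
    nlinarith
  | false =>
    simp only [cond_false, Int.ofNat_eq_natCast]
    push_cast
    have h1 : (0:ℤ) ≤ (a.natAbs:ℤ) := by positivity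
    have h2 : (0:ℤ) ≤ (b.natAbs:ℤ) := by positivity
    have e1 : (|a|)^2 = a^2 := sq_abs a
    have e2 : (|b|)^2 = b^2 := sq_abs b
    have e3 := mul_nonneg (abs_nonneg a) (abs_nonneg b)
    nlinarith

/-- integer complex number -/
def zc (a b : ℤ) : ℂ := ⟨(a:ℝ), (b:ℝ)⟩

theorem norm_zc_le (a b : ℤ) : ‖zc a b‖ ≤ nb a b := by
  have h := nb_sq a b
  have h0 : (0:ℝ) ≤ nb a b := by exact_mod_cast nb_nonneg a b
  have h1 : ((a:ℝ)^2+(b:ℝ)^2) ≤ (nb a b : ℝ)^2 := by exact_mod_cast h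
  have h2 : ‖zc a b‖^2 = (a:ℝ)^2+(b:ℝ)^2 := by
    rw [← Complex.normSq_eq_norm_sq, Complex.normSq_apply]; simp [zc]; ring
  exact abs_le_of_sq_le_sq' (by rw [h2]; exact h1) h0 |>.2

theorem norm_zc_le_add (a b : ℤ) : ‖zc a b‖ ≤ |(a:ℝ)| + |(b:ℝ)| := by
  simpa [zc] using Complex.norm_le_abs_re_add_abs_im (zc a b)

def SS : ℤ := 1000000000000
def S2 : ℤ := 1000000000000000000000000

/-- the map `G` in the normalized coordinate -/
def gB (B : ℂ) (s : ℝ) (w : ℂ) : ℂ := starRingEnd ℂ w + B * ((starRingEnd ℂ w)^2 + s)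

def step {α : Type} (bx p d mx my r : ℤ) (k : ℤ → ℤ → ℤ → α) : α :=
  fI (mx*mx-my*my) fun q => fI (2*mx*my) fun t =>
  fI (S2*mx+bx*q+p*t) fun ex => fI (p*q-bx*t-S2*my) fun ey =>
  fI (ex / S2) fun nx => fI (ey / S2) fun ny =>
  fI (nb mx my) fun M =>
  fI (nb (S2+2*(bx*mx+p*my)) (2*(p*mx-bx*my))) fun L =>
  fI ((ex - nx*S2 + (ey - ny*S2) + d*M*M + r*(L+2*d*M+SS*r) + 10*S2)/S2+1) fun r' =>
  k nx ny r'

/-- `w` lies in the ball given by integers -/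
def inB (w : ℂ) (mx my r : ℤ) : Prop := ‖(10^12 : ℂ) * w - zc mx my‖ ≤ r

structure HB (B : ℂ) (s : ℝ) (bx p d : ℤ) : Prop where
  nB : ‖B‖ = 1
  close : ‖(10^12:ℂ) * B - zc bx p‖ ≤ d
  s0 : 0 ≤ s
  s1 : s ≤ 1/10^11

theorem inB.nonneg {w : ℂ} {mx my r : ℤ} (h : inB w mx my r) : (0:ℝ) ≤ r := le_trans (norm_nonneg _) h
theorem HB.nonneg {B : ℂ} {s : ℝ} {bx p d : ℤ} (h : HB B s bx p d) : (0:ℝ) ≤ d := le_trans (norm_nonneg _) h.close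

theorem step_eq {α : Type} (bx p d mx my r : ℤ) (k : ℤ → ℤ → ℤ → α) :
    ∃ nx ny r' : ℤ, step bx p d mx my r k = k nx ny r' ∧
      ∀ (B w : ℂ) (s : ℝ), HB B s bx p d → inB w mx my r → inB (gB B s w) nx ny r' := by
  simp only [step, fI_eq]
  set q := mx*mx-my*my with hq
  set t := 2*mx*my with ht
  set ex := S2*mx+bx*q+p*t with hex
  set ey := p*q-bx*t-S2*my with hey
  set M := nb mx my with hM
  set L := nb (S2+2*(bx*mx+p*my)) (2*(p*mx-bx*my)) with hL
  set T := ex - ex/S2*S2 + (ey - ey/S2*S2) + d*M*M + r*(L+2*d*M+SS*r) + 10*S2 with hT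
  refine ⟨_, _, _, rfl, ?_⟩
  intro B w s hB hw
  have hS2 : (S2:ℤ) = 10^24 := by norm_num [S2]
  have hSS : (SS:ℤ) = 10^12 := by norm_num [SS]
  have hTd : T < (T/S2+1)*S2 := by
    have := Int.lt_ediv_add_one_mul_self T (show (0:ℤ) < S2 by norm_num [S2])
    linarith
  have hTr : (T:ℝ) ≤ ((T/S2+1:ℤ):ℝ) * 10^24 := by
    have : ((T:ℤ):ℝ) < (((T/S2+1)*S2 : ℤ):ℝ) := by exact_mod_cast hTd
    rw [hS2] at this ⊢
    push_cast at this ⊢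
    linarith
  have hr := hw.nonneg
  have hd := hB.nonneg
  unfold inB at hw ⊢
  set e := (10^12 : ℂ) * w - zc mx my with he
  set u := (10^12:ℂ) * B - zc bx p with hu
  have hwe : w = (zc mx my + e)/10^12 := by rw [he]; field_simp; ring
  have hBe : B = (zc bx p + u)/10^12 := by rw [hu]; field_simp; ring
  set m := starRingEnd ℂ (zc mx my) with hm
  have hn1 : ‖zc mx my‖ ≤ (M:ℝ) := norm_zc_le mx my
  have hmM : ‖m‖ ≤ (M:ℝ) := by rw [hm, RCLike.norm_conj]; exact hn1
  have key : (10^24:ℂ) * ((10^12:ℂ) * gB B s w - zc (ex/S2) (ey/S2)) =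
      zc (ex - ex/S2*S2) (ey - ey/S2*S2) + u * m^2
      + starRingEnd ℂ e * zc (S2+2*(bx*mx+p*my)) (2*(p*mx-bx*my))
      + 2*u*m*starRingEnd ℂ e + 10^12*B*(starRingEnd ℂ e)^2 + 10^36*B*s := by
    have h1 : zc (ex - ex/S2*S2) (ey - ey/S2*S2) = 10^24 * m + zc bx p * m^2 - 10^24 * zc (ex/S2) (ey/S2) := by
      apply Complex.ext
      · simp [zc, hm, pow_two, hex, hq, ht, hS2]; norm_num; ring
      · simp [zc, hm, pow_two, hey, hq, ht, hS2]; norm_num; ring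
    have h2 : zc (S2+2*(bx*mx+p*my)) (2*(p*mx-bx*my)) = 10^24 + 2*zc bx p*m := by
      apply Complex.ext
      · simp [zc, hm, hS2]; norm_num; ring
      · simp [zc, hm, hS2]; norm_num; ring
    rw [h1, h2]
    have h3 : starRingEnd ℂ w = (m + starRingEnd ℂ e)/10^12 := by
      conv_lhs => rw [hwe]
      rw [map_div₀, map_add, map_pow, Complex.conj_ofNat]
    unfold gB
    rw [h3]
    have h4 : u = (10^12:ℂ) * B - zc bx p := rfl
    rw [h4]
    field_simp
    ring
  have hc0 : ‖zc (ex - ex/S2*S2) (ey - ey/S2*S2)‖ ≤ ((ex - ex/S2*S2 : ℤ):ℝ) + ((ey - ey/S2*S2 : ℤ):ℝ) := by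
    refine (norm_zc_le_add _ _).trans ?_
    have h1 : 0 ≤ ex - ex/S2*S2 := by
      have := Int.ediv_mul_le ex (show (S2:ℤ) ≠ 0 by norm_num [S2]); linarith
    have h2 : 0 ≤ ey - ey/S2*S2 := by
      have := Int.ediv_mul_le ey (show (S2:ℤ) ≠ 0 by norm_num [S2]); linarith
    rw [abs_of_nonneg (by exact_mod_cast h1), abs_of_nonneg (by exact_mod_cast h2)]
  have hM0 : (0:ℝ) ≤ M := by exact_mod_cast nb_nonneg mx my
  have hL1 : ‖zc (S2+2*(bx*mx+p*my)) (2*(p*mx-bx*my))‖ ≤ (L:ℝ) := norm_zc_le _ _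
  have hec : ‖starRingEnd ℂ e‖ ≤ r := by rw [RCLike.norm_conj]; exact hw
  have hc1 : ‖u * m^2‖ ≤ d*M*M := by
    rw [norm_mul, norm_pow]
    have : ‖m‖^2 ≤ (M:ℝ)*M := by rw [pow_two]; exact mul_le_mul hmM hmM (norm_nonneg _) hM0
    calc ‖u‖*‖m‖^2 ≤ d*((M:ℝ)*M) := mul_le_mul hB.close this (by positivity) hd
      _ = _ := by ring
  have hc2 : ‖starRingEnd ℂ e * zc (S2+2*(bx*mx+p*my)) (2*(p*mx-bx*my))‖ ≤ r*L := by
    rw [norm_mul]; exact mul_le_mul hec hL1 (norm_nonneg _) hr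
  have hc3 : ‖2*u*m*starRingEnd ℂ e‖ ≤ 2*d*M*r := by
    rw [norm_mul, norm_mul, norm_mul]
    have h1 : ‖(2:ℂ)‖*‖u‖ ≤ 2*d := by
      have := hB.close
      simp only [Complex.norm_ofNat]; linarith
    exact mul_le_mul (mul_le_mul h1 hmM (norm_nonneg _) (by positivity)) hec (norm_nonneg _) (by positivity)
  have hc4 : ‖10^12*B*(starRingEnd ℂ e)^2‖ ≤ 10^12*(r*r) := by
    rw [norm_mul, norm_mul, hB.nB, norm_pow, norm_pow]
    have : ‖starRingEnd ℂ e‖^2 ≤ (r:ℝ)*r := by rw [pow_two]; exact mul_le_mul hec hec (norm_nonneg _) hr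
    simp only [Complex.norm_ofNat, mul_one]
    exact mul_le_mul_of_nonneg_left this (by positivity)
  have hc5 : ‖10^36*B*(s:ℂ)‖ ≤ 10*10^24 := by
    rw [norm_mul, norm_mul, hB.nB, norm_pow]
    have := hB.s1
    simp only [Complex.norm_ofNat, mul_one, Complex.norm_real, Real.norm_eq_abs, abs_of_nonneg hB.s0]
    linarith
  have hfin : ‖(10^24:ℂ) * ((10^12:ℂ) * gB B s w - zc (ex/S2) (ey/S2))‖ ≤ T := by
    rw [key]
    refine (norm_add_le_of_le (norm_add_le_of_le (norm_add_le_of_le (norm_add_le_of_le (norm_add_le_of_le hc0 hc1) hc2) hc3) hc4) hc5).trans ?_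
    rw [hT, hSS]
    have : ((10 * S2 : ℤ):ℝ) = 10 * 10^24 := by rw [hS2]; norm_num
    push_cast at this ⊢
    rw [this]
    apply le_of_eq
    ring
  rw [norm_mul, norm_pow] at hfin
  simp only [Complex.norm_ofNat] at hfin
  have := hfin.trans hTr
  rw [mul_comm] at this
  exact le_of_mul_le_mul_right this (by positivity)

end Tri
end

/-! ### Part 2 : the box check -/

noncomputable section

namespace Tri

def ent {α : Type} (bx p d : ℤ) (n : ℕ) : ℤ → ℤ → ℤ → (ℤ → ℤ → ℤ → α) → α :=
  Nat.rec (fun mx my r k => k mx my r)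
    (fun _ ih mx my r k => step bx p d mx my r (fun nx ny r' => ih nx ny r' k)) n

theorem ent_eq {α : Type} (bx p d : ℤ) (n : ℕ) : ∀ (mx my r : ℤ) (k : ℤ → ℤ → ℤ → α),
    ∃ nx ny r' : ℤ, ent bx p d n mx my r k = k nx ny r' ∧
      ∀ (B w : ℂ) (s : ℝ), HB B s bx p d → inB w mx my r → inB ((gB B s)^[n] w) nx ny r' := by
  induction n with
  | zero => intro mx my r k; exact ⟨mx, my, r, rfl, fun B w s _ h => h⟩
  | succ n ih =>
    intro mx my r k
    obtain ⟨nx, ny, r1, h1, h2⟩ := step_eq bx p d mx my r (fun nx ny r' => ent bx p d n nx ny r' k)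
    obtain ⟨nx2, ny2, r2, h3, h4⟩ := ih nx ny r1 k
    refine ⟨nx2, ny2, r2, h1.trans h3, fun B w s hB hw => ?_⟩
    rw [Function.iterate_succ_apply]
    exact h4 B _ s hB (h2 B w s hB hw)

def esc (bx p d : ℤ) (n : ℕ) : ℤ → ℤ → ℤ → Bool :=
  Nat.rec (fun _ _ _ => false)
    (fun _ ih mx my r =>
      fI (2*mx+bx) fun a => fI (2*my+p) fun b => fI (2800000000000+2*r+d) fun T =>
      bif Nat.blt (T.natAbs * T.natAbs) (a.natAbs * a.natAbs + b.natAbs * b.natAbs) then true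
      else step bx p d mx my r ih) n

theorem esc_sound (bx p d : ℤ) (n : ℕ) : ∀ (mx my r : ℤ), esc bx p d n mx my r = true →
    ∀ (B w : ℂ) (s : ℝ), HB B s bx p d → inB w mx my r → ∃ k, 2.8 < ‖2 * (gB B s)^[k] w + B‖ := by
  induction n with
  | zero => intro mx my r h; simp [esc] at h
  | succ n ih =>
    intro mx my r h B w s hB hw
    have h' : fI (2*mx+bx) (fun a => fI (2*my+p) fun b => fI (2800000000000+2*r+d) fun T =>
      bif Nat.blt (T.natAbs * T.natAbs) (a.natAbs * a.natAbs + b.natAbs * b.natAbs) then true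
      else step bx p d mx my r (esc bx p d n)) = true := h
    simp only [fI_eq] at h'
    cases hc : Nat.blt ((2800000000000+2*r+d).natAbs * (2800000000000+2*r+d).natAbs)
        ((2*mx+bx).natAbs * (2*mx+bx).natAbs + (2*my+p).natAbs * (2*my+p).natAbs) with
    | true =>
      refine ⟨0, ?_⟩
      simp only [Function.iterate_zero, id_eq]
      have h1 : (2800000000000+2*r+d).natAbs * (2800000000000+2*r+d).natAbs <
        (2*mx+bx).natAbs * (2*mx+bx).natAbs + (2*my+p).natAbs * (2*my+p).natAbs := by
        have := Nat.le_of_ble_eq_true hc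
        omega
      have h2 : (2800000000000+2*r+d) * (2800000000000+2*r+d) <
        (2*mx+bx) * (2*mx+bx) + (2*my+p) * (2*my+p) := by
        have := Int.ofNat_lt.mpr h1
        rw [Nat.cast_add, Int.natAbs_mul_self, Int.natAbs_mul_self, Int.natAbs_mul_self] at this
        exact this
      have h3 : ((2800000000000+2*r+d : ℝ))^2 < (2*mx+bx)^2 + (2*my+p)^2 := by
        have : (((2800000000000+2*r+d) * (2800000000000+2*r+d) : ℤ):ℝ) <
          (((2*mx+bx) * (2*mx+bx) + (2*my+p) * (2*my+p) : ℤ):ℝ) := by exact_mod_cast h2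
        push_cast at this
        nlinarith
      have h4 : ‖2 * zc mx my + zc bx p‖^2 = (2*mx+bx:ℝ)^2 + (2*my+p:ℝ)^2 := by
        rw [← Complex.normSq_eq_norm_sq, Complex.normSq_apply]; simp [zc]; ring
      have h5 : (2800000000000+2*r+d : ℝ) < ‖2 * zc mx my + zc bx p‖ := by
        rw [← h4] at h3
        exact lt_of_pow_lt_pow_left₀ 2 (norm_nonneg _) h3
      have h6 : 2 * zc mx my + zc bx p = 10^12 * (2*w+B) - 2*((10^12 : ℂ) * w - zc mx my)
        - ((10^12:ℂ) * B - zc bx p) := by ring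
      have h7 : ‖2 * zc mx my + zc bx p‖ ≤ 10^12 * ‖2*w+B‖ + 2 * r + d := by
        rw [h6]
        refine norm_sub_le_of_le (norm_sub_le_of_le ?_ ?_) hB.close
        · rw [norm_mul, norm_pow]; simp
        · rw [norm_mul]; simp only [Complex.norm_ofNat]
          have : ‖(10^12 : ℂ) * w - zc mx my‖ ≤ r := hw
          linarith
      norm_num at *
      linarith
    | false =>
      rw [hc] at h'
      simp only [cond_false] at h'
      obtain ⟨nx, ny, r1, h1, h2⟩ := step_eq bx p d mx my r (esc bx p d n)
      rw [h1] at h'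
      obtain ⟨k, hk⟩ := ih nx ny r1 h' B _ s hB (h2 B w s hB hw)
      exact ⟨k+1, by rw [Function.iterate_succ_apply]; exact hk⟩

def newt (q x : ℤ) : ℤ := (x + q / x) / 2

def bxOf {α : Type} (p : ℤ) (k : ℤ → α) : α :=
  fI (S2 - p*p) fun q => fI (newt q 829000000000) fun x => fI (newt q x) fun x =>
  fI (newt q x) fun x => fI (newt q x) k

def sqOK (bx p : ℤ) : Bool := decide (0 ≤ bx) && decide (bx*bx ≤ S2-p*p) && decide (S2-p*p < (bx+1)*(bx+1))

set_option maxHeartbeats 1000000 in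
theorem mkHB {b p s h : ℝ} {bx q D : ℤ} (hb : 0 ≤ b) (hbp : b^2+p^2=1) (hp1 : 0.548 ≤ p) (hp2 : p ≤ 0.573)
    (hs0 : 0 ≤ s) (hs1 : s ≤ 1/10^11) (hsq : sqOK bx q = true) (hq1 : 548000000000 ≤ q) (hq2 : q ≤ 573000000000)
    (hc : |10^12*p - q| ≤ h) (hD : h*5/4+3 ≤ D) : HB ⟨b,p⟩ s bx q D := by
  simp only [sqOK, Bool.and_eq_true, decide_eq_true_eq] at hsq
  obtain ⟨⟨h0, h1⟩, h2⟩ := hsq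
  have hS : (S2:ℤ) = 10^24 := by norm_num [S2]
  rw [hS] at h1 h2
  have h0' : (0:ℝ) ≤ bx := by exact_mod_cast h0
  have h1' : (bx:ℝ)*bx ≤ 10^24 - q*q := by exact_mod_cast h1
  have h2' : (10:ℝ)^24 - q*q < (bx+1)*(bx+1) := by exact_mod_cast h2
  have hq1' : (548000000000:ℝ) ≤ q := by exact_mod_cast hq1
  have hq2' : (q:ℝ) ≤ 573000000000 := by exact_mod_cast hq2
  have hh : 0 ≤ h := (abs_nonneg _).trans hc
  refine ⟨?_, ?_, hs0, hs1⟩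
  · have : ‖(⟨b,p⟩:ℂ)‖^2 = 1 := by
      rw [← Complex.normSq_eq_norm_sq, Complex.normSq_apply]; simp; nlinarith
    nlinarith [norm_nonneg (⟨b,p⟩:ℂ)]
  · -- main estimate
    set b0 := Real.sqrt (10^24 - (q:ℝ)^2) with hb0
    have hb0n : 0 ≤ b0 := Real.sqrt_nonneg _
    have hpos : (0:ℝ) ≤ 10^24 - (q:ℝ)^2 := by nlinarith
    have hb0s : b0^2 = 10^24 - (q:ℝ)^2 := Real.sq_sqrt hpos
    have e1 : (bx:ℝ) ≤ b0 := by
      apply Real.le_sqrt_of_sq_le; nlinarith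
    have e2 : b0 ≤ bx+1 := by
      apply Real.sqrt_le_iff.mpr; constructor
      · linarith
      · nlinarith
    have b0l : (810000000000:ℝ) ≤ b0 := by
      apply Real.le_sqrt_of_sq_le; nlinarith
    have bl : (0.81:ℝ) ≤ b := by nlinarith
    have e3 : (10^12*b - b0)*(10^12*b+b0) = (q - 10^12*p)*(q+10^12*p) := by
      have : b^2 = 1-p^2 := by linarith
      nlinarith
    have e4 : |10^12*b - b0| ≤ 0.715 * h := by
      have h5 : |10^12*b - b0| * (10^12*b+b0) = |10^12*p-q| * (q+10^12*p) := by
        have := congrArg abs e3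
        rw [abs_mul, abs_mul, abs_of_nonneg (show (0:ℝ) ≤ 10^12*b+b0 by positivity),
          abs_of_nonneg (show (0:ℝ) ≤ q+10^12*p by linarith), abs_sub_comm (q:ℝ)] at this
        exact this
      have h6 : |10^12*p-q| * (q+10^12*p) ≤ h * (1.146*10^12) :=
        mul_le_mul hc (by linarith) (by linarith) hh
      have h7 : |10^12*b - b0| * (1.62*10^12) ≤ |10^12*b - b0| * (10^12*b+b0) :=
        mul_le_mul_of_nonneg_left (by linarith) (abs_nonneg _)
      rw [h5] at h7
      have h8 := h7.trans h6
      clear h5 h6 h7 e3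
      generalize |10^12*b - b0| = v at h8 ⊢
      norm_num at h8 ⊢
      linarith
    have e5 : (10^12:ℂ) * ⟨b,p⟩ - zc bx q = (⟨10^12*b-b0, 10^12*p-q⟩:ℂ) + ⟨b0-bx,0⟩ := by
      apply Complex.ext <;> simp [zc] <;> norm_num
    rw [e5]
    have e6 : ‖(⟨10^12*b-b0, 10^12*p-q⟩:ℂ)‖ ≤ 1.25*h := by
      have : ‖(⟨10^12*b-b0, 10^12*p-q⟩:ℂ)‖^2 ≤ (1.25*h)^2 := by
        rw [← Complex.normSq_eq_norm_sq, Complex.normSq_apply]; simp only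
        have a1 := sq_abs (10^12*b-b0)
        have a2 := sq_abs (10^12*p-q)
        have a3 := pow_le_pow_left₀ (abs_nonneg _) e4 2
        have a4 := pow_le_pow_left₀ (abs_nonneg _) hc 2
        rw [a1] at a3
        rw [a2] at a4
        generalize 10^12*b-b0 = v1 at *
        generalize 10^12*p-q = v2 at *
        norm_num at *
        nlinarith
      exact le_of_sq_le_sq this (by positivity)
    have e7 : ‖(⟨b0-bx,0⟩:ℂ)‖ ≤ 1 := by
      have : (⟨b0-bx,0⟩:ℂ) = ((b0-bx:ℝ):ℂ) := rfl
      rw [this, Complex.norm_real, Real.norm_eq_abs, abs_le]; constructor <;> linarith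
    refine (norm_add_le_of_le e6 e7).trans ?_
    linarith

theorem inB.re {w : ℂ} {mx my r : ℤ} (h : inB w mx my r) : (mx - r : ℝ) ≤ 10^12*w.re ∧ 10^12*w.re ≤ mx + r := by
  have h1 := (Complex.abs_re_le_norm _).trans h
  have h2 : ((10^12 : ℂ) * w - zc mx my).re = 10^12*w.re - mx := by simp [zc]; norm_num
  rw [h2, abs_le] at h1
  constructor <;> linarith
theorem inB.im {w : ℂ} {mx my r : ℤ} (h : inB w mx my r) : (my - r : ℝ) ≤ 10^12*w.im ∧ 10^12*w.im ≤ my + r := by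
  have h1 := (Complex.abs_im_le_norm _).trans h
  have h2 : ((10^12 : ℂ) * w - zc mx my).im = 10^12*w.im - my := by simp [zc]; norm_num
  rw [h2, abs_le] at h1
  constructor <;> linarith

end Tri
end

/-! ### Part 3 : box facts -/

noncomputable section

namespace Tri

/-- `D` and the height -/
def DD (s : ℝ) (w : ℂ) : ℝ := w.re^2 + w.im^2 + s
def eta (s : ℝ) (w : ℂ) : ℝ := w.im / DD s w

theorem start_inB {B : ℂ} {s : ℝ} {bx p d : ℤ} (h : HB B s bx p d) :
    inB (gB B s (-B/2)) (-bx/4) (p/4) (d/4+13) := by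
  have hk : gB B s (-B/2) = -(starRingEnd ℂ B)/4 + B * s := by
    have h1 : B * starRingEnd ℂ B = 1 := by
      rw [Complex.mul_conj, Complex.normSq_eq_norm_sq, h.nB]; simp
    have h2 : starRingEnd ℂ (-B/2) = -(starRingEnd ℂ B)/2 := by
      rw [map_div₀, map_neg, Complex.conj_ofNat]
    unfold gB
    rw [h2]
    linear_combination (starRingEnd ℂ B)/4 * h1
  unfold inB
  have e : (10^12:ℂ) * gB B s (-B/2) - zc (-bx/4) (p/4) =
      (-(starRingEnd ℂ ((10^12:ℂ)*B - zc bx p))/4 + 10^12*B*s) + (-(starRingEnd ℂ (zc bx p))/4 - zc (-bx/4) (p/4)) := by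
    rw [hk, map_sub, map_mul, map_pow, Complex.conj_ofNat]; ring
  rw [e]
  have n1 : ‖-(starRingEnd ℂ ((10^12:ℂ)*B - zc bx p))/4‖ ≤ (d:ℝ)/4 := by
    rw [norm_div, norm_neg, RCLike.norm_conj, Complex.norm_ofNat]
    exact div_le_div_of_nonneg_right h.close (by norm_num)
  have n2 : ‖10^12*B*(s:ℂ)‖ ≤ 10 := by
    rw [norm_mul, norm_mul, h.nB, norm_pow]
    have := h.s1
    simp only [Complex.norm_ofNat, mul_one, Complex.norm_real, Real.norm_eq_abs, abs_of_nonneg h.s0]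
    linarith
  have n3 : ‖-(starRingEnd ℂ (zc bx p))/4 - zc (-bx/4) (p/4)‖ ≤ 1 + 1 := by
    refine (Complex.norm_le_abs_re_add_abs_im _).trans ?_
    have f1 : 4 * (-bx/4) ≤ -bx := by omega
    have f2 : -bx < 4 * (-bx/4) + 4 := by omega
    have f3 : 4 * (p/4) ≤ p := by omega
    have f4 : p < 4 * (p/4) + 4 := by omega
    have f1' : 4 * (((-bx/4:ℤ)):ℝ) ≤ -bx := by exact_mod_cast f1
    have f2' : (-bx:ℝ) < 4 * ((-bx/4:ℤ):ℝ) + 4 := by exact_mod_cast f2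
    have f3' : 4 * (((p/4:ℤ)):ℝ) ≤ p := by exact_mod_cast f3
    have f4' : (p:ℝ) < 4 * ((p/4:ℤ):ℝ) + 4 := by exact_mod_cast f4
    have g1 : (-(starRingEnd ℂ (zc bx p))/4 - zc (-bx/4) (p/4)).re = -bx/4 - ((-bx/4:ℤ):ℝ) := by
      have : (-(starRingEnd ℂ (zc bx p))/4) = ((1/4:ℝ):ℂ) * (-(starRingEnd ℂ (zc bx p))) := by push_cast; ring
      rw [this, Complex.sub_re, Complex.re_ofReal_mul]; simp [zc]; ring
    have g2 : (-(starRingEnd ℂ (zc bx p))/4 - zc (-bx/4) (p/4)).im = p/4 - ((p/4:ℤ):ℝ) := by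
      have : (-(starRingEnd ℂ (zc bx p))/4) = ((1/4:ℝ):ℂ) * (-(starRingEnd ℂ (zc bx p))) := by push_cast; ring
      rw [this, Complex.sub_im, Complex.im_ofReal_mul]; simp [zc]; ring
    rw [g1, g2]
    apply add_le_add <;> rw [abs_le] <;> constructor <;> linarith
  refine (norm_add_le_of_le (norm_add_le_of_le n1 n2) n3).trans ?_
  have : d < 4*(d/4)+4 := by omega
  have h5 : (d:ℝ) < 4*((d/4:ℤ):ℝ)+4 := by exact_mod_cast this
  push_cast at h5 ⊢
  linarith

theorem eta_lo {s : ℝ} {w : ℂ} {mx my r e dlo : ℤ} (hw : inB w mx my r) (he : e ≤ 0)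
    (hD : 0 < DD s w) (hd : (dlo:ℝ) ≤ 10^24 * DD s w) (hc : e*dlo ≤ (my-r)*S2) : (e:ℝ)/10^12 ≤ eta s w := by
  have h1 := hw.im.1
  have he' : (e:ℝ) ≤ 0 := by exact_mod_cast he
  have hS : (S2:ℤ) = 10^24 := by norm_num [S2]
  rw [hS] at hc
  have hc' : (e:ℝ)*dlo ≤ (my-r)*10^24 := by exact_mod_cast hc
  have h2 := mul_le_mul_of_nonpos_left hd he'
  unfold eta
  rw [div_le_div_iff₀ (by positivity) hD]
  linarith

theorem eta_hi {s : ℝ} {w : ℂ} {mx my r e dhi : ℤ} (hw : inB w mx my r) (he : e ≤ 0)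
    (hD : 0 < DD s w) (hd : 10^24 * DD s w ≤ dhi) (hc : (my+r)*S2 ≤ e*dhi) : eta s w ≤ (e:ℝ)/10^12 := by
  have h1 := hw.im.2
  have he' : (e:ℝ) ≤ 0 := by exact_mod_cast he
  have hS : (S2:ℤ) = 10^24 := by norm_num [S2]
  rw [hS] at hc
  have hc' : ((my+r)*10^24:ℝ) ≤ (e:ℝ)*dhi := by exact_mod_cast hc
  have h2 := mul_le_mul_of_nonpos_left hd he'
  unfold eta
  rw [div_le_div_iff₀ hD (by positivity)]
  linarith

def piece (bx p d y1 rad j : ℤ) : Bool := fI (y1+(2*j+1)*rad) fun y => esc bx p d 30 49700000000 y rad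

def winchk (bx p d e1 e2 : ℤ) : Bool :=
  fI ((e1 - 10300000000) * 2495730000000000000000 / S2 - 1) fun y1 =>
  fI ((e2 + 101100000000) * 2470090000000000000000 / S2 + 1) fun y2 =>
  fI ((y2 - y1)/8+1) fun rad =>
  piece bx p d y1 rad 0 && piece bx p d y1 rad 1 && piece bx p d y1 rad 2 && piece bx p d y1 rad 3

def etachk (k : ℤ → ℤ → Bool) (mx my r : ℤ) : Bool :=
  decide (-48000000000 ≤ mx - r) && decide (mx + r ≤ -46000000000) && decide (-5000000000 ≤ my - r)
  && decide (my + r ≤ 0) &&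
  (fI ((-mx-r)*(-mx-r)+(-my-r)*(-my-r)) fun dlo =>
   fI ((-mx+r)*(-mx+r)+(-my+r)*(-my+r)+10000000000000) fun dhi =>
   fI ((my-r)*S2/dlo) fun e1 => fI ((my+r)*S2/dhi+1) fun e2 =>
   decide (0 < dlo) && decide (0 < dhi) && decide (e2 ≤ 0) && decide (e1 ≤ 0) && k e1 e2)

theorem etachk_sound {k : ℤ → ℤ → Bool} {mx my r : ℤ} (h : etachk k mx my r = true) :
    ∃ e1 e2 : ℤ, k e1 e2 = true ∧ ∀ (w : ℂ) (s : ℝ), 0 ≤ s → s ≤ 1/10^11 → inB w mx my r →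
      -0.048 ≤ w.re ∧ w.re ≤ -0.046 ∧ -0.005 ≤ w.im ∧ w.im ≤ 0 ∧ (e1:ℝ)/10^12 ≤ eta s w ∧ eta s w ≤ (e2:ℝ)/10^12 := by
  simp only [etachk, fI_eq, Bool.and_eq_true, decide_eq_true_eq] at h
  obtain ⟨⟨⟨⟨h1, h2⟩, h3⟩, h4⟩, ⟨⟨⟨h5, h6⟩, h7⟩, h8⟩, h9⟩ := h
  refine ⟨_, _, h9, fun w s hs0 hs1 hw => ?_⟩
  have a1 : (-48000000000:ℝ) ≤ mx - r := by exact_mod_cast h1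
  have a2 : (mx + r:ℝ) ≤ -46000000000 := by exact_mod_cast h2
  have a3 : (-5000000000:ℝ) ≤ my - r := by exact_mod_cast h3
  have a4 : (my + r:ℝ) ≤ 0 := by exact_mod_cast h4
  have r1 := hw.re
  have r2 := hw.im
  have hr := hw.nonneg
  have hD : 0 < DD s w := by
    unfold DD
    have : w.re ≤ -0.046 := by norm_num; linarith
    nlinarith [sq_nonneg w.im]
  have b1 : (-mx-r:ℝ)^2 ≤ (10^12*w.re)^2 := by
    have : (10^12*w.re)^2 = (-(10^12*w.re))^2 := by ring
    rw [this]; exact pow_le_pow_left₀ (by linarith) (by linarith) 2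
  have b2 : (-my-r:ℝ)^2 ≤ (10^12*w.im)^2 := by
    have : (10^12*w.im)^2 = (-(10^12*w.im))^2 := by ring
    rw [this]; exact pow_le_pow_left₀ (by linarith) (by linarith) 2
  have b3 : (10^12*w.re)^2 ≤ (-mx+r:ℝ)^2 := by
    have : (10^12*w.re)^2 = (-(10^12*w.re))^2 := by ring
    rw [this]; exact pow_le_pow_left₀ (by linarith) (by linarith) 2
  have b4 : (10^12*w.im)^2 ≤ (-my+r:ℝ)^2 := by
    have : (10^12*w.im)^2 = (-(10^12*w.im))^2 := by ring
    rw [this]; exact pow_le_pow_left₀ (by linarith) (by linarith) 2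
  refine ⟨by norm_num; linarith, by norm_num; linarith, by norm_num; linarith, by linarith, ?_, ?_⟩
  · refine eta_lo hw h8 hD (dlo := (-mx-r)*(-mx-r)+(-my-r)*(-my-r)) ?_ (Int.ediv_mul_le _ h5.ne')
    push_cast; unfold DD; linarith
  · refine eta_hi hw h7 hD (dhi := (-mx+r)*(-mx+r)+(-my+r)*(-my+r)+10000000000000) ?_ ?_
    · push_cast; unfold DD; linarith
    · exact (Int.lt_ediv_add_one_mul_self _ h6).le

theorem win_sound {bx p d e1 e2 : ℤ} (he1 : e1 ≤ 0) (he2 : e2 ≤ -1425000000000) (h : winchk bx p d e1 e2 = true)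
    {B : ℂ} {s : ℝ} (hB : HB B s bx p d) {y : ℝ} (hy : |y| ≤ 0.005)
    (h1 : (e1:ℝ)/10^12 - 0.0103 ≤ eta s ⟨0.0497, y⟩) (h2 : eta s ⟨0.0497, y⟩ ≤ (e2:ℝ)/10^12 + 0.1011) :
    ∃ n, 2.8 < ‖2 * (gB B s)^[n] ⟨0.0497, y⟩ + B‖ := by
  simp only [winchk, fI_eq, Bool.and_eq_true] at h
  obtain ⟨⟨⟨p0, p1⟩, p2⟩, p3⟩ := h
  set y1 := (e1 - 10300000000) * 2495730000000000000000 / S2 - 1 with hy1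
  set y2 := (e2 + 101100000000) * 2470090000000000000000 / S2 + 1 with hy2
  set rad := (y2-y1)/8+1 with hrad
  have hS : (S2:ℤ) = 10^24 := by norm_num [S2]
  have c1 : (y1+1) * 10^24 ≤ (e1 - 10300000000) * 2495730000000000000000 := by
    rw [hy1, ← hS]; simp only [sub_add_cancel]; exact Int.ediv_mul_le _ (by norm_num [S2])
  have c2 : (e2 + 101100000000) * 2470090000000000000000 < y2 * 10^24 := by
    rw [hy2, ← hS]; exact Int.lt_ediv_add_one_mul_self _ (by norm_num [S2])
  have c3 : y2 - y1 ≤ 8*rad := by omega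
  have c1' : ((y1:ℝ)+1) * 10^24 ≤ (e1 - 10300000000) * 2495730000000000000000 := by exact_mod_cast c1
  have c2' : ((e2:ℝ) + 101100000000) * 2470090000000000000000 < y2 * 10^24 := by exact_mod_cast c2
  have c3' : (y2:ℝ) - y1 ≤ 8*rad := by exact_mod_cast c3
  have e1' : (e1:ℝ) ≤ 0 := by exact_mod_cast he1
  have e2' : (e2:ℝ) ≤ -1425000000000 := by exact_mod_cast he2
  have hs0 := hB.s0
  have hs1 := hB.s1
  unfold eta at h1 h2
  have hDe : DD s ⟨0.0497, y⟩ = 0.0497^2 + y^2 + s := rfl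
  have ysq : y^2 ≤ 0.005^2 := by
    rw [← sq_abs]; exact pow_le_pow_left₀ (abs_nonneg _) hy 2
  have hD1 : 0.0497^2 ≤ DD s ⟨0.0497, y⟩ := by rw [hDe]; nlinarith [sq_nonneg y]
  have hD2 : DD s ⟨0.0497, y⟩ ≤ 0.00249573 := by rw [hDe]; norm_num at *; linarith
  have hD : 0 < DD s ⟨0.0497, y⟩ := by norm_num at *; linarith
  rw [le_div_iff₀ hD] at h1
  rw [div_le_iff₀ hD] at h2
  simp only at h1 h2
  set D := DD s ⟨0.0497, y⟩ with hDdef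
  have g1 : ((e1:ℝ)/10^12 - 0.0103) * 0.00249573 ≤ y :=
    le_trans (mul_le_mul_of_nonpos_left hD2 (by norm_num; linarith)) h1
  have g2 : y ≤ ((e2:ℝ)/10^12 + 0.1011) * 0.0497^2 :=
    le_trans h2 (mul_le_mul_of_nonpos_left hD1 (by norm_num; linarith))
  have k1 : (y1:ℝ) ≤ 10^12*y := by norm_num at *; linarith
  have k2 : 10^12*y ≤ (y2:ℝ) := by norm_num at *; linarith
  have fin : ∀ j : ℤ, piece bx p d y1 rad j = true → (y1 + 2*j*rad:ℝ) ≤ 10^12*y → 10^12*y ≤ y1+2*(j+1)*rad →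
      ∃ n, 2.8 < ‖2 * (gB B s)^[n] ⟨0.0497, y⟩ + B‖ := by
    intro j hj l1 l2
    simp only [piece, fI_eq] at hj
    refine esc_sound bx p d 30 _ _ _ hj B _ s hB ?_
    unfold inB
    have : (10^12:ℂ) * ⟨0.0497, y⟩ - zc 49700000000 (y1+(2*j+1)*rad) = ((10^12*y - (y1+(2*j+1)*rad) : ℝ):ℂ) * Complex.I := by
      apply Complex.ext <;> simp [zc] <;> norm_num
    rw [this, norm_mul, Complex.norm_I, mul_one, Complex.norm_real, Real.norm_eq_abs, abs_le]
    constructor <;> linarith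
  rcases le_total (10^12*y) ((y1:ℝ)+2*rad) with m | m
  · exact fin 0 p0 (by push_cast; linarith) (by push_cast; linarith)
  rcases le_total (10^12*y) ((y1:ℝ)+4*rad) with m2 | m2
  · exact fin 1 p1 (by push_cast; linarith) (by push_cast; linarith)
  rcases le_total (10^12*y) ((y1:ℝ)+6*rad) with m3 | m3
  · exact fin 2 p2 (by push_cast; linarith) (by push_cast; linarith)
  · exact fin 3 p3 (by push_cast; linarith) (by push_cast; linarith)

def boxchk (i : ℕ) : Bool :=
  fI (548000000000 + 500000000*(2*(i:ℤ)+1)) fun p => bxOf p fun bx =>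
  sqOK bx p && ent bx p 625000003 21 (-bx/4) (p/4) (625000003/4+13)
    (etachk fun e1 e2 => decide (-1605000000000 ≤ e1) && decide (e1 ≤ 0) && decide (e2 ≤ -1425000000000) && winchk bx p 625000003 e1 e2)

set_option maxRecDepth 100000 in
theorem boxchk_all : ∀ i < 25, boxchk i = true := by decide +kernel

theorem bxOf_eq {α : Type} (p : ℤ) : ∃ bx : ℤ, ∀ (k : ℤ → α), bxOf p k = k bx := by
  simp only [bxOf, fI_eq]; exact ⟨_, fun _ => rfl⟩

theorem box_fact {b p s : ℝ} (hb : 0 ≤ b) (hbp : b^2+p^2=1) (hp1 : 0.548 ≤ p) (hp2 : p ≤ 0.573)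
    (hs0 : 0 ≤ s) (hs1 : s ≤ 1/10^11) :
    ∃ W : ℂ, (gB ⟨b,p⟩ s)^[22] (-⟨b,p⟩/2) = W ∧ ∃ e1 e2 : ℝ,
      -0.048 ≤ W.re ∧ W.re ≤ -0.046 ∧ -0.005 ≤ W.im ∧ W.im ≤ 0 ∧ e1 ≤ eta s W ∧ eta s W ≤ e2 ∧
      -1.605 ≤ e1 ∧ e2 ≤ -1.425 ∧
      ∀ y, |y| ≤ 0.005 → e1 - 0.0103 ≤ eta s ⟨0.0497, y⟩ → eta s ⟨0.0497, y⟩ ≤ e2 + 0.1011 →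
        ∃ n, 2.8 < ‖2 * (gB ⟨b,p⟩ s)^[n] ⟨0.0497, y⟩ + ⟨b,p⟩‖ := by
  refine ⟨_, rfl, ?_⟩
  obtain ⟨i, hi, hc⟩ : ∃ i : ℕ, i < 25 ∧ |10^12*p - (548000000000 + 500000000*(2*(i:ℤ)+1) : ℤ)| ≤ 500000000 := by
    set i := ⌊(p-0.548)*1000⌋₊ with hi
    have h0 : 0 ≤ (p-0.548)*1000 := by norm_num at *; linarith
    have f1 := Nat.floor_le h0
    have f2 := Nat.lt_floor_add_one ((p-0.548)*1000)
    rw [← hi] at f1 f2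
    rcases lt_or_ge i 25 with h | h
    · refine ⟨i, h, ?_⟩
      push_cast
      rw [abs_le]; norm_num at *; constructor <;> linarith
    · refine ⟨24, by norm_num, ?_⟩
      have h' : (25:ℝ) ≤ i := by exact_mod_cast h
      push_cast
      rw [abs_le]; norm_num at f1 hp2 ⊢; constructor <;> linarith
  have hk := boxchk_all i hi
  simp only [boxchk, fI_eq] at hk
  obtain ⟨bx, hbx⟩ := bxOf_eq (α := Bool) (548000000000 + 500000000*(2*(i:ℤ)+1))
  rw [hbx] at hk
  set q := (548000000000 + 500000000*(2*(i:ℤ)+1)) with hq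
  simp only [Bool.and_eq_true] at hk
  obtain ⟨k1, k2⟩ := hk
  have hB : HB ⟨b,p⟩ s bx q 625000003 :=
    mkHB hb hbp hp1 hp2 hs0 hs1 k1 (by omega) (by omega) hc (by norm_num)
  obtain ⟨nx, ny, r, e, hw⟩ := ent_eq bx q 625000003 21 (-bx/4) (q/4) (625000003/4+13)
    (etachk fun e1 e2 => decide (-1605000000000 ≤ e1) && decide (e1 ≤ 0) && decide (e2 ≤ -1425000000000) && winchk bx q 625000003 e1 e2)
  rw [e] at k2
  obtain ⟨e1, e2, hk, hww⟩ := etachk_sound k2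
  simp only [Bool.and_eq_true, decide_eq_true_eq] at hk
  obtain ⟨⟨⟨l1, l2⟩, l3⟩, l4⟩ := hk
  have hW := hw _ _ s hB (start_inB hB)
  rw [← Function.iterate_succ_apply] at hW
  obtain ⟨m1, m2, m3, m4, m5, m6⟩ := hww _ s hs0 hs1 hW
  refine ⟨_, _, m1, m2, m3, m4, m5, m6, ?_, ?_, ?_⟩
  · have : (-1605000000000:ℝ) ≤ e1 := by exact_mod_cast l1
    norm_num; linarith
  · have : (e2:ℝ) ≤ -1425000000000 := by exact_mod_cast l3
    norm_num; linarith
  · intro y hy h1 h2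
    exact win_sound l2 l3 l4 hB hy h1 h2

end Tri
end

/-! ### Part 4 : inverse branches and the target -/

noncomputable section

namespace Tri

def disc (B : ℂ) (s : ℝ) (v : ℂ) : ℂ := 1 + 4 * B * (v - B * s)

def sgn (e : Bool) : ℂ := if e then 1 else -1

theorem sgn_sq (e : Bool) : sgn e * sgn e = 1 := by cases e <;> simp [sgn]

def csq (q : ℂ) : ℂ := Complex.exp (Complex.log q / 2)

theorem csq_sq {q : ℂ} (h : q ≠ 0) : csq q * csq q = q := by
  unfold csq
  rw [← Complex.exp_add, add_halves, Complex.exp_log h]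

theorem csq_re (q : ℂ) : 0 ≤ (csq q).re := by
  unfold csq
  rw [Complex.exp_re]
  have h1 : (Complex.log q / 2).im = q.arg/2 := by
    have : Complex.log q / 2 = ((1/2:ℝ):ℂ) * Complex.log q := by push_cast; ring
    rw [this, Complex.im_ofReal_mul, Complex.log_im]; ring
  rw [h1]
  refine mul_nonneg (Real.exp_pos _).le (Real.cos_nonneg_of_mem_Icc ⟨?_, ?_⟩)
  · linarith [Complex.neg_pi_lt_arg q]
  · linarith [Complex.arg_le_pi q]

def ginv (B : ℂ) (s : ℝ) (e : Bool) (v : ℂ) : ℂ :=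
  starRingEnd ℂ ((sgn e * csq (disc B s v) - 1) * starRingEnd ℂ B / 2)

theorem mul_conj_one {B : ℂ} (hB : ‖B‖ = 1) : B * starRingEnd ℂ B = 1 := by
  rw [Complex.mul_conj, Complex.normSq_eq_norm_sq, hB]; simp

theorem gB_ginv {B : ℂ} {s : ℝ} (hB : ‖B‖ = 1) (e : Bool) {v : ℂ} (h : disc B s v ≠ 0) :
    gB B s (ginv B s e v) = v := by
  have h1 := mul_conj_one hB
  have h2 := csq_sq h
  have h3 := sgn_sq e
  unfold gB ginv
  rw [Complex.conj_conj]
  have hd : disc B s v = 1 + 4 * B * (v - B * s) := rfl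
  set c := csq (disc B s v)
  set C := starRingEnd ℂ B
  rw [hd] at h2
  have h4 : (sgn e * c)*(sgn e * c) = 1 + 4 * B * (v - B * s) := by
    rw [← h2]; linear_combination c*c*h3
  set z := sgn e * c
  -- multiply by B
  have hB0 : B ≠ 0 := by intro h0; rw [h0] at hB; simp at hB
  apply mul_left_cancel₀ hB0
  linear_combination (1/4 : ℂ) * h4 + ((z-1)/2 + (z-1)^2/4*(B*C+1)) * h1

theorem inv_ball {B v n : ℂ} {s a l ρ : ℝ} {e : Bool} (hB : ‖B‖ = 1)
    (ha : 0 < a) (ha1 : a ≤ (sgn e * (1 + 2*B*starRingEnd ℂ n)).re) (hl : l ≤ ‖1 + 2*B*starRingEnd ℂ n‖)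
    (hρ : ‖v - B*s - starRingEnd ℂ n - B * (starRingEnd ℂ n)^2‖ ≤ ρ) (h1 : 4*ρ < a^2) (h2 : 0 < l*a-2*ρ) :
    disc B s v ∈ Complex.slitPlane ∧ ‖ginv B s e v - n‖ ≤ ρ * a / (l*a-2*ρ) := by
  have hρ0 : 0 ≤ ρ := (norm_nonneg _).trans hρ
  set σ := sgn e * (1 + 2*B*starRingEnd ℂ n) with hσ
  have hσσ : σ * σ = (1 + 2*B*starRingEnd ℂ n)^2 := by
    rw [hσ]; linear_combination (1 + 2*B*starRingEnd ℂ n)^2 * sgn_sq e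
  have hσn : ‖σ‖ = ‖1 + 2*B*starRingEnd ℂ n‖ := by
    rw [hσ, norm_mul]; cases e <;> simp [sgn]
  have hq : disc B s v - σ*σ = 4*B*(v - B*s - starRingEnd ℂ n - B * (starRingEnd ℂ n)^2) := by
    rw [hσσ]; unfold disc; ring
  have hqn : ‖disc B s v - σ*σ‖ ≤ 4*ρ := by
    rw [hq, norm_mul, norm_mul, hB, Complex.norm_ofNat]; linarith
  have hslit : disc B s v ∈ Complex.slitPlane := by
    by_contra hn
    rw [Complex.mem_slitPlane_iff, not_or, not_lt, not_not] at hn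
    obtain ⟨r1, r2⟩ := hn
    set y := Real.sqrt (-(disc B s v).re) with hy
    have hy2 : y*y = -(disc B s v).re := Real.mul_self_sqrt (by linarith)
    have hfac : disc B s v - σ*σ = -((σ - y*Complex.I)*(σ+y*Complex.I)) := by
      have : disc B s v = -((y:ℂ)*y) := by
        apply Complex.ext
        · simp [hy2]
        · simp [r2]
      rw [this]; linear_combination -(y:ℂ)*y*Complex.I_mul_I
    rw [hfac, norm_neg, norm_mul] at hqn
    have n1 : a ≤ ‖σ - y*Complex.I‖ := by
      refine le_trans ?_ (Complex.re_le_norm _)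
      simpa using ha1
    have n2 : a ≤ ‖σ + y*Complex.I‖ := by
      refine le_trans ?_ (Complex.re_le_norm _)
      simpa using ha1
    have := mul_le_mul n1 n2 ha.le (norm_nonneg _)
    nlinarith
  refine ⟨hslit, ?_⟩
  have h0 : disc B s v ≠ 0 := Complex.slitPlane_ne_zero hslit
  set c := csq (disc B s v) with hc
  have hcc : c*c = disc B s v := csq_sq h0
  have hcr : 0 ≤ c.re := csq_re _
  have hf : ‖c - σ‖ * ‖c + σ‖ ≤ 4*ρ := by
    rw [← norm_mul]
    have : (c-σ)*(c+σ) = disc B s v - σ*σ := by rw [← hcc]; ring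
    rw [this]; exact hqn
  have g1 : a ≤ ‖c+σ‖ := by
    refine le_trans ?_ (Complex.re_le_norm _)
    rw [Complex.add_re]; linarith
  have g2 : 2*l ≤ ‖c+σ‖ + ‖c-σ‖ := by
    have : 2*σ = (c+σ) - (c-σ) := by ring
    have h3 : ‖2*σ‖ ≤ ‖c+σ‖ + ‖c-σ‖ := by rw [this]; exact norm_sub_le _ _
    rw [norm_mul, Complex.norm_ofNat, hσn] at h3
    linarith
  have g3 : ginv B s e v - n = starRingEnd ℂ ((sgn e * (c - σ)) * starRingEnd ℂ B / 2) := by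
    have hn : n = starRingEnd ℂ (starRingEnd ℂ n) := (Complex.conj_conj n).symm
    have hh := mul_conj_one hB
    have : ginv B s e v - n = starRingEnd ℂ ((sgn e * c - 1) * starRingEnd ℂ B / 2 - starRingEnd ℂ n) := by
      rw [map_sub, Complex.conj_conj]; rfl
    rw [this, hσ]
    congr 1
    linear_combination (starRingEnd ℂ n) * hh + (1 + 2*B*starRingEnd ℂ n)*starRingEnd ℂ B / 2 * sgn_sq e
  have g4 : ‖ginv B s e v - n‖ = ‖c-σ‖/2 := by
    rw [g3, RCLike.norm_conj, norm_div, norm_mul, RCLike.norm_conj, hB, norm_mul, Complex.norm_ofNat]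
    cases e <;> simp [sgn]
  rw [g4, div_le_div_iff₀ (by norm_num) h2]
  set u := ‖c-σ‖ with hu
  set t := ‖c+σ‖ with ht
  have hu0 : 0 ≤ u := norm_nonneg _
  -- u*t ≤ 4ρ, a ≤ t, 2l ≤ t+u
  have k1 : u*a ≤ 4*ρ := (mul_le_mul_of_nonneg_left g1 hu0).trans hf
  have k2 : u*(2*l - u) ≤ 4*ρ := (mul_le_mul_of_nonneg_left (by linarith) hu0).trans hf
  have k3 := mul_le_mul_of_nonneg_left k2 ha.le
  have k4 := mul_le_mul_of_nonneg_left k1 hu0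
  nlinarith

def tg (B : ℂ) (s : ℝ) : List Bool → ℂ → ℂ
  | [], v => v
  | e :: l, v => tg B s l (ginv B s e v)

def istep (bx p d : ℤ) (e : Bool) (nx ny mx my r : ℤ) (k : ℤ → Bool) : Bool :=
  fI (nx*nx-ny*ny) fun qx => fI (-2*nx*ny) fun qy =>
  fI (S2*mx-S2*nx-(bx*qx-p*qy)) fun ex => fI (S2*my+S2*ny-(p*qx+bx*qy)) fun ey =>
  fI (nb nx ny) fun M =>
  fI ((ex.natAbs+ey.natAbs+d*M*M)/S2+1+r+10) fun ρ =>
  fI (S2+2*(bx*nx+p*ny)) fun lx => fI (2*(p*nx-bx*ny)) fun ly =>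
  fI (lx*lx+ly*ly) fun q => fI (newt q (nb lx ly)) fun x => fI (newt q x) fun x => fI (newt q x) fun x =>
  fI (x/SS-2-2*d*M/SS-1) fun l =>
  fI ((bif e then lx else -lx)/SS-2*d*M/SS-1) fun a =>
  fI (l*a-2*ρ*SS) fun den =>
  decide (0 < a) && decide (0 ≤ l) && decide (0 < den) && decide (4*ρ*SS < a*a) &&
  decide (a*SS+2*d*M ≤ (bif e then lx else -lx)) && decide ((l*SS+2*d*M)*(l*SS+2*d*M) ≤ lx*lx+ly*ly) &&
  (fI (ρ*a*SS/den+1) k)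

theorem istep_sound {bx p d : ℤ} {e : Bool} {nx ny mx my r : ℤ} {k : ℤ → Bool}
    (h : istep bx p d e nx ny mx my r k = true) :
    ∃ r' : ℤ, k r' = true ∧ ∀ (B v : ℂ) (s : ℝ), HB B s bx p d → inB v mx my r →
      disc B s v ∈ Complex.slitPlane ∧ inB (ginv B s e v) nx ny r' := by
  simp only [istep, fI_eq, Bool.and_eq_true, decide_eq_true_eq] at h
  set qx := nx*nx-ny*ny with hqx
  set qy := -2*nx*ny with hqy
  set ex := S2*mx-S2*nx-(bx*qx-p*qy) with hex
  set ey := S2*my+S2*ny-(p*qx+bx*qy) with hey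
  set M := nb nx ny with hM
  set Q := (ex.natAbs+ey.natAbs+d*M*M : ℤ) with hQ
  set ρ := Q/S2+1+r+10 with hρ
  set lx := S2+2*(bx*nx+p*ny) with hlx
  set ly := 2*(p*nx-bx*ny) with hly
  set nn := newt (lx*lx+ly*ly) (newt (lx*lx+ly*ly) (newt (lx*lx+ly*ly) (nb lx ly))) with hnn0
  set l := nn/SS-2-2*d*M/SS-1 with hl
  set a := (bif e then lx else -lx)/SS-2*d*M/SS-1 with ha
  set den := l*a-2*ρ*SS with hden
  obtain ⟨⟨⟨⟨⟨⟨h1, h2⟩, h3⟩, h4⟩, h5⟩, h6⟩, h7⟩ := h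
  refine ⟨_, h7, fun B v s hB hv => ?_⟩
  have hS2 : (S2:ℤ) = 10^24 := by norm_num [S2]
  have hSS : (SS:ℤ) = 10^12 := by norm_num [SS]
  have hQd : Q < (Q/S2+1)*S2 := Int.lt_ediv_add_one_mul_self Q (by norm_num [S2])
  have hQr : (Q:ℝ) < ((Q/S2:ℤ)+1)*10^24 := by
    have : ((Q:ℤ):ℝ) < (((Q/S2+1)*S2 : ℤ):ℝ) := by exact_mod_cast hQd
    rw [hS2] at this ⊢
    push_cast at this ⊢
    linarith
  have hρr : (ρ:ℝ) = ((Q/S2:ℤ):ℝ)+1+r+10 := by rw [hρ]; push_cast; rfl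
  have hnn := norm_zc_le nx ny
  rw [← hM] at hnn
  have hM0 : (0:ℝ) ≤ M := by exact_mod_cast nb_nonneg nx ny
  have hd := hB.nonneg
  set N := starRingEnd ℂ (zc nx ny) with hN
  have hNM : ‖N‖ ≤ (M:ℝ) := by rw [hN, RCLike.norm_conj]; exact hnn
  set n : ℂ := zc nx ny / 10^12 with hn
  have hcn : starRingEnd ℂ n = N/10^12 := by rw [hn, map_div₀, map_pow, Complex.conj_ofNat]
  set u := (10^12:ℂ) * B - zc bx p with hu
  have hBe : B = (zc bx p + u)/10^12 := by rw [hu]; field_simp; ring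
  set δ := (10^12:ℂ) * v - zc mx my with hδ
  have hve : v = (zc mx my + δ)/10^12 := by rw [hδ]; field_simp; ring
  have hδr : ‖δ‖ ≤ r := hv
  have hur : ‖u‖ ≤ d := hB.close
  -- linear coefficient
  have hlc : (10^24:ℂ) * (1 + 2*B*starRingEnd ℂ n) = zc lx ly + 2*u*N := by
    have : zc lx ly = 10^24 + 2*zc bx p*N := by
      apply Complex.ext
      · simp [zc, hN, hlx, hS2]; norm_num; ring
      · simp [zc, hN, hly]; norm_num; ring
    rw [this, hcn, hu]; field_simp; ring
  have huN : ‖2*u*N‖ ≤ 2*d*M := by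
    rw [norm_mul, norm_mul, Complex.norm_ofNat]
    exact mul_le_mul (by linarith) hNM (norm_nonneg _) (by positivity)
  have hla : (l:ℝ)/10^12 ≤ ‖1 + 2*B*starRingEnd ℂ n‖ := by
    have e1 : ((l:ℝ)*10^12+2*d*M)^2 ≤ (lx:ℝ)^2+(ly:ℝ)^2 := by
      rw [hSS] at h6
      have : (((l*10^12+2*d*M)*(l*10^12+2*d*M) : ℤ):ℝ) ≤ ((lx*lx+ly*ly : ℤ):ℝ) := by exact_mod_cast h6
      push_cast at this
      linarith
    have e2 : ‖zc lx ly‖^2 = (lx:ℝ)^2+(ly:ℝ)^2 := by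
      rw [← Complex.normSq_eq_norm_sq, Complex.normSq_apply]; simp [zc]; ring
    rw [← e2] at e1
    have e3 := le_of_sq_le_sq e1 (norm_nonneg _)
    have e4 : ‖zc lx ly‖ ≤ ‖(10^24:ℂ) * (1 + 2*B*starRingEnd ℂ n)‖ + 2*d*M := by
      have : zc lx ly = (10^24:ℂ) * (1 + 2*B*starRingEnd ℂ n) - 2*u*N := by rw [hlc]; ring
      rw [this]
      exact norm_sub_le_of_le le_rfl huN
    rw [norm_mul, norm_pow, Complex.norm_ofNat] at e4
    rw [div_le_iff₀ (by positivity)]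
    linarith
  have haa : (a:ℝ)/10^12 ≤ (sgn e * (1 + 2*B*starRingEnd ℂ n)).re := by
    have e1 : (10^24:ℝ) * (sgn e * (1 + 2*B*starRingEnd ℂ n)).re = (sgn e * zc lx ly).re + (sgn e*(2*u*N)).re := by
      rw [← Complex.add_re, ← mul_add, ← hlc, ← Complex.re_ofReal_mul]
      congr 1; push_cast; ring
    have e2 : -(2*d*M) ≤ (sgn e*(2*u*N)).re := by
      have : ‖sgn e*(2*u*N)‖ ≤ 2*d*M := by
        rw [norm_mul]; refine le_trans (le_of_eq ?_) huN
        cases e <;> simp [sgn]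
      have h8 := (abs_le.mp ((Complex.abs_re_le_norm _).trans this)).1
      exact h8
    have e3 : (sgn e * zc lx ly).re = ((bif e then lx else -lx : ℤ):ℝ) := by
      cases e <;> simp [sgn, zc]
    rw [hSS] at h5
    have h5' : (a:ℝ)*10^12+2*d*M ≤ ((bif e then lx else -lx : ℤ):ℝ) := by exact_mod_cast h5
    rw [div_le_iff₀ (by positivity)]
    linarith
  have hres : ‖v - B*s - starRingEnd ℂ n - B * (starRingEnd ℂ n)^2‖ ≤ (ρ:ℝ)/10^12 := by
    have key : (10^36:ℂ) * (v - B*s - starRingEnd ℂ n - B * (starRingEnd ℂ n)^2) =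
        zc ex ey + 10^24 * δ - u * N^2 - 10^36*B*s := by
      have : zc ex ey = 10^24 * zc mx my - 10^24 * N - zc bx p * N^2 := by
        apply Complex.ext
        · simp [zc, hN, hex, hS2, hqx, hqy, pow_two]; norm_num; ring
        · simp [zc, hN, hey, hS2, hqx, hqy, pow_two]; norm_num; ring
      rw [this, hcn, hδ, hu]; field_simp; ring
    have c0 : ‖zc ex ey‖ ≤ |(ex:ℝ)| + |(ey:ℝ)| := norm_zc_le_add _ _
    have c1 : ‖10^24 * δ‖ ≤ 10^24*r := by
      rw [norm_mul, norm_pow, Complex.norm_ofNat]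
      exact mul_le_mul_of_nonneg_left hδr (by positivity)
    have c2 : ‖u * N^2‖ ≤ d*(M*M) := by
      rw [norm_mul, norm_pow, pow_two]
      exact mul_le_mul hur (mul_le_mul hNM hNM (norm_nonneg _) hM0) (by positivity) hd
    have c3 : ‖10^36*B*(s:ℂ)‖ ≤ 10*10^24 := by
      rw [norm_mul, norm_mul, hB.nB, norm_pow]
      have := hB.s1
      simp only [Complex.norm_ofNat, mul_one, Complex.norm_real, Real.norm_eq_abs, abs_of_nonneg hB.s0]
      linarith
    have tot := norm_sub_le_of_le (norm_sub_le_of_le (norm_add_le_of_le c0 c1) c2) c3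
    rw [← key, norm_mul, norm_pow, Complex.norm_ofNat] at tot
    have hQQ : (Q:ℝ) = |(ex:ℝ)| + |(ey:ℝ)| + d*M*M := by rw [hQ]; push_cast; rfl
    rw [le_div_iff₀ (by positivity)]
    rw [hρr]
    generalize ‖v - B*s - starRingEnd ℂ n - B * (starRingEnd ℂ n)^2‖ = z at *
    linarith
  have h1' : (0:ℝ) < a := by exact_mod_cast h1
  have h4' : 4*(ρ:ℝ)*10^12 < a*a := by rw [hSS] at h4; exact_mod_cast h4
  have hdr : (den:ℝ) = l*a-2*ρ*10^12 := by rw [hden, hSS]; push_cast; norm_num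
  have h3' : (0:ℝ) < den := by exact_mod_cast h3
  have fin := inv_ball (s := s) hB.nB (show (0:ℝ) < (a:ℝ)/10^12 by positivity) haa hla hres
    (by rw [div_pow, ← mul_div_assoc, div_lt_div_iff₀ (by positivity) (by positivity)]; nlinarith)
    (by
      have : (l:ℝ)/10^12*((a:ℝ)/10^12) - 2*((ρ:ℝ)/10^12) = den/10^24 := by rw [hdr]; field_simp
      rw [this]; positivity)
  refine ⟨fin.1, ?_⟩
  have f2 := fin.2
  have e5 : (ρ:ℝ)/10^12*((a:ℝ)/10^12)/((l:ℝ)/10^12*((a:ℝ)/10^12) - 2*((ρ:ℝ)/10^12)) = ρ*a/den := by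
    have : (l:ℝ)/10^12*((a:ℝ)/10^12) - 2*((ρ:ℝ)/10^12) = den/10^24 := by rw [hdr]; field_simp
    rw [this]; field_simp
  rw [e5] at f2
  unfold inB
  have e6 : (10^12:ℂ) * ginv B s e v - zc nx ny = 10^12 * (ginv B s e v - n) := by rw [hn]; field_simp
  rw [e6, norm_mul, norm_pow, Complex.norm_ofNat]
  have e7 : ρ*a*SS < (ρ*a*SS/den+1)*den := Int.lt_ediv_add_one_mul_self _ h3
  rw [hSS] at e7 ⊢
  have e8 : (ρ:ℝ)*a*10^12 < ((ρ*a*10^12/den+1:ℤ):ℝ)*den := by exact_mod_cast e7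
  calc (10^12:ℝ) * ‖ginv B s e v - n‖ ≤ 10^12 * (ρ*a/den) := mul_le_mul_of_nonneg_left f2 (by positivity)
    _ = ρ*a*10^12/den := by ring
    _ ≤ _ := by rw [div_le_iff₀ h3']; exact e8.le

end Tri
end

/-! ### Part 5 : the target point -/

noncomputable section

namespace Tri

def ichk (bx p d : ℤ) : List (Bool × ℤ × ℤ) → ℤ → ℤ → ℤ → (ℤ → ℤ → ℤ → Bool) → Bool :=
  List.rec (fun mx my r k => k mx my r)
    (fun x _ ih mx my r k => istep bx p d x.1 x.2.1 x.2.2 mx my r (fun r' => ih x.2.1 x.2.2 r' k))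

theorem ichk_sound {bx p d : ℤ} {k : ℤ → ℤ → ℤ → Bool} (l : List (Bool × ℤ × ℤ)) : ∀ {mx my r : ℤ},
    ichk bx p d l mx my r k = true →
    ∃ nx ny r' : ℤ, k nx ny r' = true ∧ ∀ (Z : Set (ℂ × ℝ)) (v : ℂ × ℝ → ℂ), (∀ q ∈ Z, HB q.1 q.2 bx p d) →
      (∀ q ∈ Z, inB (v q) mx my r) → ContinuousOn v Z →
      (∀ q ∈ Z, inB (tg q.1 q.2 (l.map Prod.fst) (v q)) nx ny r' ∧
        (gB q.1 q.2)^[l.length] (tg q.1 q.2 (l.map Prod.fst) (v q)) = v q) ∧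
      ContinuousOn (fun q => tg q.1 q.2 (l.map Prod.fst) (v q)) Z := by
  induction l with
  | nil =>
    intro mx my r h
    exact ⟨mx, my, r, h, fun Z v _ h2 h3 => ⟨fun q hq => ⟨h2 q hq, rfl⟩, h3⟩⟩
  | cons x l ih =>
    intro mx my r h
    obtain ⟨r1, h1, h2⟩ := istep_sound (k := fun r' => ichk bx p d l x.2.1 x.2.2 r' k) h
    obtain ⟨nx, ny, r', h3, h4⟩ := ih h1
    refine ⟨nx, ny, r', h3, fun Z v hZ hv hc => ?_⟩
    have hc' : ContinuousOn (fun q : ℂ × ℝ => ginv q.1 q.2 x.1 (v q)) Z := by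
      unfold ginv
      apply Complex.continuous_conj.comp_continuousOn
      have hdc : ContinuousOn (fun q : ℂ × ℝ => disc q.1 q.2 (v q)) Z := by
        unfold disc
        fun_prop
      have : ContinuousOn (fun q : ℂ × ℝ => csq (disc q.1 q.2 (v q))) Z := by
        unfold csq
        exact ((hdc.clog fun q hq => (h2 q.1 (v q) q.2 (hZ q hq) (hv q hq)).1).div_const 2).cexp
      have h5 : ContinuousOn (fun q : ℂ × ℝ => starRingEnd ℂ q.1) Z :=
        (Complex.continuous_conj.comp continuous_fst).continuousOn
      exact (((continuousOn_const.mul this).sub continuousOn_const).mul h5).div_const 2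
    obtain ⟨h6, h7⟩ := h4 Z (fun q => ginv q.1 q.2 x.1 (v q)) hZ
      (fun q hq => (h2 q.1 (v q) q.2 (hZ q hq) (hv q hq)).2) hc'
    refine ⟨fun q hq => ⟨(h6 q hq).1, ?_⟩, h7⟩
    have h8 := (h6 q hq).2
    rw [List.length_cons, Function.iterate_succ_apply']
    have h9 : tg q.1 q.2 ((x :: l).map Prod.fst) (v q) = tg q.1 q.2 (l.map Prod.fst) (ginv q.1 q.2 x.1 (v q)) := rfl
    rw [h9, h8]
    exact gB_ginv (hZ q hq).nB x.1 (Complex.slitPlane_ne_zero (h2 q.1 (v q) q.2 (hZ q hq) (hv q hq)).1)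

theorem crit_inB {B : ℂ} {s : ℝ} {bx p d : ℤ} (h : HB B s bx p d) :
    inB (-B/2) (-bx/2) (-p/2) (d/2+2) := by
  unfold inB
  have e : (10^12:ℂ) * (-B/2) - zc (-bx/2) (-p/2) =
      -((10^12:ℂ)*B - zc bx p)/2 + (-(zc bx p)/2 - zc (-bx/2) (-p/2)) := by ring
  rw [e]
  have n1 : ‖-((10^12:ℂ)*B - zc bx p)/2‖ ≤ (d:ℝ)/2 := by
    rw [norm_div, norm_neg, Complex.norm_ofNat]
    exact div_le_div_of_nonneg_right h.close (by norm_num)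
  have n3 : ‖-(zc bx p)/2 - zc (-bx/2) (-p/2)‖ ≤ 1/2 + 1/2 := by
    refine (Complex.norm_le_abs_re_add_abs_im _).trans ?_
    have f1 : 2 * (-bx/2) ≤ -bx := by omega
    have f2 : -bx ≤ 2 * (-bx/2) + 1 := by omega
    have f3 : 2 * (-p/2) ≤ -p := by omega
    have f4 : -p ≤ 2 * (-p/2) + 1 := by omega
    have f1' : 2 * (((-bx/2:ℤ)):ℝ) ≤ -bx := by exact_mod_cast f1
    have f2' : (-bx:ℝ) ≤ 2 * ((-bx/2:ℤ):ℝ) + 1 := by exact_mod_cast f2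
    have f3' : 2 * (((-p/2:ℤ)):ℝ) ≤ -p := by exact_mod_cast f3
    have f4' : (-p:ℝ) ≤ 2 * ((-p/2:ℤ):ℝ) + 1 := by exact_mod_cast f4
    have g1 : (-(zc bx p)/2 - zc (-bx/2) (-p/2)).re = -bx/2 - ((-bx/2:ℤ):ℝ) := by
      have : (-(zc bx p)/2) = ((1/2:ℝ):ℂ) * (-(zc bx p)) := by push_cast; ring
      rw [this, Complex.sub_re, Complex.re_ofReal_mul]; simp [zc]; ring
    have g2 : (-(zc bx p)/2 - zc (-bx/2) (-p/2)).im = -p/2 - ((-p/2:ℤ):ℝ) := by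
      have : (-(zc bx p)/2) = ((1/2:ℝ):ℂ) * (-(zc bx p)) := by push_cast; ring
      rw [this, Complex.sub_im, Complex.im_ofReal_mul]; simp [zc]; ring
    rw [g1, g2]
    apply add_le_add <;> rw [abs_le] <;> constructor <;> linarith
  refine (norm_add_le_of_le n1 n3).trans ?_
  have : d ≤ 2*(d/2)+1 := by omega
  have h5 : (d:ℝ) ≤ 2*((d/2:ℤ):ℝ)+1 := by exact_mod_cast this
  push_cast at h5 ⊢
  linarith

def tlW : List (Bool × ℤ × ℤ) :=
  [
    (false, -589453448943, -941942488610), (false, -749082632842, -1297808845151), (false, -789475644598, -1461682208058),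
    (true, -11429135204, 961638168912), (true, 442349452925, -613437113505), (true, 330969326930, 382827910882),
    (true, 351365989718, -214563900224), (true, 266059013906, 165780467614), (true, 249236634168, -96381889631),
    (true, 202052987253, 86236255353), (true, 186427585288, -52171855131), (true, 158640424998, 51317658284),
    (true, 146890897807, -32010140254), (true, 129151833676, 33551303083), (true, 120413815197, -21411024280),
    (true, 108306239226, 23467369376), (true, 101674064680, -15237259359), (true, 92964951053, 17257205821),
    (true, 87804776888, -11356607708), (true, 81276638617, 13186580058), (true, 77167559079, -8770969218),
    (true, 72111001435, 10384782314), (true, 68771565862, -6967450355), (true, 64749473045, 8379344876),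
    (true, 61987357261, -5662284048), (true, 58717494614, 6897289148), (true, 56397999438, -4688816082),
    (true, 53690834989, 5772550616), (true, 51717336432, -3944246881)]

def tlA : List (Bool × ℤ × ℤ) :=
  [
    (false, -592340803720, -932107696737), (false, -754988387456, -1286164766660), (false, -795514151064, -1450590362689),
    (true, -11658912037, 961217545390), (true, 438180645484, -613596702163), (true, 330263423557, 382303937135),
    (true, 349515891145, -215015225444), (true, 265307864860, 165390815048), (true, 248078778409, -96635182873),
    (true, 201351405131, 85959399894), (true, 185558434615, -52312928190), (true, 158005719057, 51116334444),
    (true, 146180221884, -32093771043), (true, 128580199665, 33399943815), (true, 119806051472, -21463686175),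
    (true, 107789420869, 23349998328), (true, 101140128076, -15272119114), (true, 92494778664, 17163754320),
    (true, 87327175201, -11380632555), (true, 80846089691, 13110507589), (true, 76734741717, -8788075206),
    (true, 71714283257, 10321696216), (true, 68375397816, -6979957835), (true, 64381857072, 8326201141),
    (true, 61621838337, -5671631202), (true, 58375116278, 6851918311), (true, 56058548991, -4695929135),
    (true, 53370516943, 5733367711), (true, 51400363115, -3949742213)]

def tlB : List (Bool × ℤ × ℤ) :=
  [
    (false, -586357785043, -951799665038), (false, -742992712286, -1309431919820), (false, -783225522954, -1472769542992),
    (true, -11200571871, 962050015548), (true, 446577662979, -613256570152), (true, 331694365601, 383370281836),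
    (true, 353256251040, -214106519188), (true, 266835368040, 166184576959), (true, 250427231492, -96126310815),
    (true, 202779459457, 86523441966), (true, 187324721144, -52029771806), (true, 159298301893, 51526568892),
    (true, 147626104418, -31926037106), (true, 129744758088, 33708438340), (true, 121043457882, -21358148936),
    (true, 108842611867, 23589278267), (true, 102227770941, -15202321117), (true, 93453145655, 17354315870),
    (true, 88300425852, -11332578128), (true, 81723873762, 13265665404), (true, 77616988248, -8753899735),
    (true, 72523241310, 10450393526), (true, 69183129458, -6955002423), (true, 65131591653, 8434636293),
    (true, 62367227067, -5653008917), (true, 59073478840, 6944509593), (true, 56750893106, -4681781227),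
    (true, 54023965062, 5813343571), (true, 52046956566, -3938832106)]

def word : List Bool := tlW.map Prod.fst

/-- the target point -/
def tgt (B : ℂ) (s : ℝ) : ℂ := tg B s word (-B/2)

def tchk (k : ℤ → ℤ → ℤ → ℤ → Bool) (mx my r : ℤ) : Bool :=
  decide (50500000000 ≤ mx - r) && decide (mx + r ≤ 52800000000) && decide (-9000000000 ≤ my - r)
  && decide (my + r ≤ 0) &&
  (fI ((mx-r)*(mx-r)+(-my-r)*(-my-r)) fun dlo =>
   fI ((mx+r)*(mx+r)+(-my+r)*(-my+r)+10000000000000) fun dhi =>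
   k dlo dhi (my-r) (my+r))

theorem tchk_sound {k : ℤ → ℤ → ℤ → ℤ → Bool} {mx my r : ℤ} (h : tchk k mx my r = true) :
    ∃ dlo dhi ylo yhi : ℤ, k dlo dhi ylo yhi = true ∧ ∀ (w : ℂ) (s : ℝ), 0 ≤ s → s ≤ 1/10^11 → inB w mx my r →
      0.0505 ≤ w.re ∧ w.re ≤ 0.0528 ∧ -0.009 ≤ w.im ∧ w.im ≤ 0 ∧
      (∀ e : ℤ, e ≤ 0 → e*dlo ≤ ylo*S2 → (e:ℝ)/10^12 ≤ eta s w) ∧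
      (∀ e : ℤ, e ≤ 0 → yhi*S2 ≤ e*dhi → eta s w ≤ (e:ℝ)/10^12) := by
  simp only [tchk, fI_eq, Bool.and_eq_true, decide_eq_true_eq] at h
  obtain ⟨⟨⟨⟨h1, h2⟩, h3⟩, h4⟩, h9⟩ := h
  refine ⟨_, _, _, _, h9, fun w s hs0 hs1 hw => ?_⟩
  have a1 : (50500000000:ℝ) ≤ mx - r := by exact_mod_cast h1
  have a2 : (mx + r:ℝ) ≤ 52800000000 := by exact_mod_cast h2
  have a3 : (-9000000000:ℝ) ≤ my - r := by exact_mod_cast h3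
  have a4 : (my + r:ℝ) ≤ 0 := by exact_mod_cast h4
  have r1 := hw.re
  have r2 := hw.im
  have hr := hw.nonneg
  have hD : 0 < DD s w := by
    unfold DD
    have : 0.0505 ≤ w.re := by norm_num; linarith
    nlinarith [sq_nonneg w.im]
  have b1 : (mx-r:ℝ)^2 ≤ (10^12*w.re)^2 := pow_le_pow_left₀ (by linarith) (by linarith) 2
  have b2 : (-my-r:ℝ)^2 ≤ (10^12*w.im)^2 := by
    have : (10^12*w.im)^2 = (-(10^12*w.im))^2 := by ring
    rw [this]; exact pow_le_pow_left₀ (by linarith) (by linarith) 2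
  have b3 : (10^12*w.re)^2 ≤ (mx+r:ℝ)^2 := pow_le_pow_left₀ (by linarith) (by linarith) 2
  have b4 : (10^12*w.im)^2 ≤ (-my+r:ℝ)^2 := by
    have : (10^12*w.im)^2 = (-(10^12*w.im))^2 := by ring
    rw [this]; exact pow_le_pow_left₀ (by linarith) (by linarith) 2
  refine ⟨by norm_num; linarith, by norm_num; linarith, by norm_num; linarith, by linarith, ?_, ?_⟩
  · intro e h8 h5
    refine eta_lo hw h8 hD (dlo := (mx-r)*(mx-r)+(-my-r)*(-my-r)) ?_ h5
    push_cast; unfold DD; linarith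
  · intro e h8 h5
    refine eta_hi hw h8 hD (dhi := (mx+r)*(mx+r)+(-my+r)*(-my+r)+10000000000000) ?_ h5
    push_cast; unfold DD; linarith

def fullchk (p d : ℤ) (l : List (Bool × ℤ × ℤ)) (k : ℤ → ℤ → ℤ → ℤ → Bool) : Bool :=
  bxOf p fun bx => sqOK bx p && ichk bx p d l (-bx/2) (-p/2) (d/2+2) (tchk k)

theorem fullchk_sound {p d : ℤ} {l : List (Bool × ℤ × ℤ)} {k : ℤ → ℤ → ℤ → ℤ → Bool} (hl : l.map Prod.fst = word)
    (h : fullchk p d l k = true) :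
    ∃ bx : ℤ, sqOK bx p = true ∧ ∃ dlo dhi ylo yhi : ℤ, k dlo dhi ylo yhi = true ∧
      (∀ B s, HB B s bx p d → 0.0505 ≤ (tgt B s).re ∧ (tgt B s).re ≤ 0.0528 ∧ -0.009 ≤ (tgt B s).im ∧ (tgt B s).im ≤ 0 ∧
      (∀ e : ℤ, e ≤ 0 → e*dlo ≤ ylo*S2 → (e:ℝ)/10^12 ≤ eta s (tgt B s)) ∧
      (∀ e : ℤ, e ≤ 0 → yhi*S2 ≤ e*dhi → eta s (tgt B s) ≤ (e:ℝ)/10^12) ∧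
      (gB B s)^[29] (tgt B s) = -B/2) ∧
      ContinuousOn (fun q : ℂ × ℝ => tgt q.1 q.2) {q | HB q.1 q.2 bx p d} := by
  unfold fullchk at h
  obtain ⟨bx, hbx⟩ := bxOf_eq (α := Bool) p
  rw [hbx, Bool.and_eq_true] at h
  refine ⟨bx, h.1, ?_⟩
  obtain ⟨nx, ny, r, h1, h2⟩ := ichk_sound l h.2
  obtain ⟨dlo, dhi, ylo, yhi, h3, h4⟩ := tchk_sound h1
  have hlen : l.length = 29 := by
    have : (l.map Prod.fst).length = 29 := by rw [hl]; rfl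
    simpa using this
  obtain ⟨h5, h6⟩ := h2 {q | HB q.1 q.2 bx p d} (fun q => -q.1/2) (fun q hq => hq) (fun q hq => crit_inB hq) (by fun_prop)
  rw [hl] at h5 h6
  rw [hlen] at h5
  refine ⟨dlo, dhi, ylo, yhi, h3, fun B s hB => ?_, h6⟩
  obtain ⟨h7, h8⟩ := h5 (B, s) hB
  obtain ⟨g1, g2, g3, g4, g5, g6⟩ := h4 _ s hB.s0 hB.s1 h7
  exact ⟨g1, g2, g3, g4, g5, g6, h8⟩

set_option maxRecDepth 100000 in
theorem chkW : fullchk 560500000000 13125000003 tlW (fun _ _ _ _ => true) = true := by decide +kernel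
set_option maxRecDepth 100000 in
theorem chkA : fullchk 550000000000 3 tlA (fun _ dhi _ yhi => decide (yhi*S2 ≤ -1480000000000*dhi)) = true := by decide +kernel
set_option maxRecDepth 100000 in
theorem chkB : fullchk 571000000000 3 tlB (fun dlo _ ylo _ => decide (-1450000000000*dlo ≤ ylo*S2)) = true := by decide +kernel

theorem target_fact : ∃ Z : Set (ℂ × ℝ), ContinuousOn (fun q : ℂ × ℝ => tgt q.1 q.2) Z ∧
    ∀ b p s : ℝ, 0 ≤ b → b^2+p^2=1 → 0.55 ≤ p → p ≤ 0.571 → 0 ≤ s → s ≤ 1/10^11 →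
      ((⟨b,p⟩:ℂ), s) ∈ Z ∧ 0.0505 ≤ (tgt ⟨b,p⟩ s).re ∧ (tgt ⟨b,p⟩ s).re ≤ 0.0528 ∧ -0.009 ≤ (tgt ⟨b,p⟩ s).im ∧
      (tgt ⟨b,p⟩ s).im ≤ 0 ∧ (gB ⟨b,p⟩ s)^[29] (tgt ⟨b,p⟩ s) = -⟨b,p⟩/2 := by
  obtain ⟨bx, h1, dlo, dhi, ylo, yhi, -, h3, h4⟩ := fullchk_sound rfl chkW
  refine ⟨_, h4, fun b p s hb hbp hp1 hp2 hs0 hs1 => ?_⟩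
  have hB : HB ⟨b,p⟩ s bx 560500000000 13125000003 :=
    mkHB (h := 10500000000) hb hbp (by norm_num at *; linarith) (by norm_num at *; linarith) hs0 hs1 h1 (by norm_num) (by norm_num)
      (by rw [abs_le]; push_cast; norm_num at *; constructor <;> linarith) (by norm_num)
  obtain ⟨g1, g2, g3, g4, g5, g6, g7⟩ := h3 _ _ hB
  exact ⟨hB, g1, g2, g3, g4, g7⟩

theorem tgt_A {b s : ℝ} (hb : 0 ≤ b) (hbp : b^2+0.55^2=1) (hs0 : 0 ≤ s) (hs1 : s ≤ 1/10^11) :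
    eta s (tgt ⟨b,0.55⟩ s) ≤ -1.48 := by
  obtain ⟨bx, h1, dlo, dhi, ylo, yhi, h2, h3, h4⟩ := fullchk_sound (by decide) chkA
  have hB : HB ⟨b,0.55⟩ s bx 550000000000 3 :=
    mkHB (h := 0) hb hbp (by norm_num) (by norm_num) hs0 hs1 h1 (by norm_num) (by norm_num)
      (by norm_num) (by norm_num)
  obtain ⟨g1, g2, g3, g4, g5, g6, g7⟩ := h3 _ _ hB
  refine (g6 (-1480000000000) (by norm_num) (by simpa using h2)).trans (by norm_num)

theorem tgt_B {b s : ℝ} (hb : 0 ≤ b) (hbp : b^2+0.571^2=1) (hs0 : 0 ≤ s) (hs1 : s ≤ 1/10^11) :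
    -1.45 ≤ eta s (tgt ⟨b,0.571⟩ s) := by
  obtain ⟨bx, h1, dlo, dhi, ylo, yhi, h2, h3, h4⟩ := fullchk_sound (by decide) chkB
  have hB : HB ⟨b,0.571⟩ s bx 571000000000 3 :=
    mkHB (h := 0) hb hbp (by norm_num) (by norm_num) hs0 hs1 h1 (by norm_num) (by norm_num)
      (by norm_num) (by norm_num)
  obtain ⟨g1, g2, g3, g4, g5, g6, g7⟩ := h3 _ _ hB
  refine le_trans (by norm_num) (g5 (-1450000000000) (by norm_num) (by simpa using h2))

def endchk (p : ℤ) (k : ℤ → ℤ → Bool) : Bool :=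
  bxOf p fun bx => sqOK bx p && ent bx p 3 21 (-bx/4) (p/4) (3/4+13) (etachk k)

theorem endchk_sound {p : ℤ} {k : ℤ → ℤ → Bool} (h : endchk p k = true) : ∃ bx : ℤ, sqOK bx p = true ∧
    ∃ e1 e2 : ℤ, k e1 e2 = true ∧ ∀ B s, HB B s bx p 3 →
      (e1:ℝ)/10^12 ≤ eta s ((gB B s)^[22] (-B/2)) ∧ eta s ((gB B s)^[22] (-B/2)) ≤ (e2:ℝ)/10^12 := by
  unfold endchk at h
  obtain ⟨bx, hbx⟩ := bxOf_eq (α := Bool) p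
  rw [hbx, Bool.and_eq_true] at h
  refine ⟨bx, h.1, ?_⟩
  have k2 := h.2
  obtain ⟨nx, ny, r, e, hw⟩ := ent_eq bx p 3 21 (-bx/4) (p/4) (3/4+13) (etachk k)
  rw [e] at k2
  obtain ⟨e1, e2, hk, hww⟩ := etachk_sound k2
  refine ⟨e1, e2, hk, fun B s hB => ?_⟩
  have hW := hw _ _ s hB (start_inB hB)
  rw [← Function.iterate_succ_apply] at hW
  obtain ⟨m1, m2, m3, m4, m5, m6⟩ := hww _ s hB.s0 hB.s1 hW
  exact ⟨m5, m6⟩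

set_option maxRecDepth 100000 in
theorem endA : endchk 550000000000 (fun e1 _ => decide (-1460000000000 ≤ e1)) = true := by decide +kernel
set_option maxRecDepth 100000 in
theorem endB : endchk 571000000000 (fun _ e2 => decide (e2 ≤ -1555000000000)) = true := by decide +kernel

theorem W_A {b s : ℝ} (hb : 0 ≤ b) (hbp : b^2+0.55^2=1) (hs0 : 0 ≤ s) (hs1 : s ≤ 1/10^11) :
    -1.46 ≤ eta s ((gB ⟨b,0.55⟩ s)^[22] (-⟨b,0.55⟩/2)) := by
  obtain ⟨bx, h1, e1, e2, h2, h3⟩ := endchk_sound endA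
  have hB : HB ⟨b,0.55⟩ s bx 550000000000 3 :=
    mkHB (h := 0) hb hbp (by norm_num) (by norm_num) hs0 hs1 h1 (by norm_num) (by norm_num)
      (by norm_num) (by norm_num)
  refine le_trans ?_ (h3 _ _ hB).1
  have : -1460000000000 ≤ e1 := by simpa using h2
  have : (-1460000000000:ℝ) ≤ e1 := by exact_mod_cast this
  norm_num at *; linarith

theorem W_B {b s : ℝ} (hb : 0 ≤ b) (hbp : b^2+0.571^2=1) (hs0 : 0 ≤ s) (hs1 : s ≤ 1/10^11) :
    eta s ((gB ⟨b,0.571⟩ s)^[22] (-⟨b,0.571⟩/2)) ≤ -1.555 := by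
  obtain ⟨bx, h1, e1, e2, h2, h3⟩ := endchk_sound endB
  have hB : HB ⟨b,0.571⟩ s bx 571000000000 3 :=
    mkHB (h := 0) hb hbp (by norm_num) (by norm_num) hs0 hs1 h1 (by norm_num) (by norm_num)
      (by norm_num) (by norm_num)
  refine (h3 _ _ hB).2.trans ?_
  have : e2 ≤ -1555000000000 := by simpa using h2
  have : (e2:ℝ) ≤ -1555000000000 := by exact_mod_cast this
  norm_num at *; linarith

end Tri
end

/-! ### Part 6 : the gate step -/

noncomputable section

namespace Tri

theorem mulbd {u v U V : ℝ} (h1 : |u| ≤ U) (h2 : |v| ≤ V) : |u*v| ≤ U*V := by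
  rw [abs_mul]; exact mul_le_mul h1 h2 (abs_nonneg _) ((abs_nonneg _).trans h1)

theorem sqbd {u U : ℝ} (h1 : |u| ≤ U) : u^2 ≤ U^2 := by
  rw [← sq_abs]; exact pow_le_pow_left₀ (abs_nonneg _) h1 2

theorem gate1 {s x y D η a c : ℝ}
    (hs1 : s ≤ 1/10^11) (hx1 : -0.048 ≤ x) (hx2 : x ≤ 0.053)
    (hη1 : -1.62 ≤ η) (hη2 : η ≤ -1.32) (hD0 : 0 < D) (hD1 : D ≤ 0.004) (hy : y = η*D) (hD : D = x^2+y^2+s)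
    (ha : a = 1-2*η*y) (hc : c = 2*η*x) :
    D ≤ 0.00287 ∧ |y| ≤ 0.0047 ∧ a ≤ 1 ∧ 0.9845 ≤ a ∧ |c| ≤ 0.172 := by
  have ηb : |η| ≤ 1.62 := abs_le.mpr ⟨hη1, by linarith only [hη2]⟩
  have xb : |x| ≤ 0.053 := abs_le.mpr ⟨by linarith only [hx1], hx2⟩
  have yb0 : |y| ≤ 1.62*0.004 := by
    rw [hy]; exact mulbd ηb (abs_le.mpr ⟨by linarith only [hD0], hD1⟩)
  have ysq := sqbd yb0
  have xsq := sqbd xb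
  have D2 : D ≤ 0.00287 := by linarith only [hD, xsq, ysq, hs1]
  have Db : |D| ≤ 0.00287 := abs_le.mpr ⟨by linarith only [hD0], D2⟩
  have yb : |y| ≤ 0.0047 := by
    rw [hy]; exact (mulbd ηb Db).trans (by norm_num)
  have yneg : y ≤ 0 := by
    rw [hy]; exact mul_nonpos_of_nonpos_of_nonneg (by linarith only [hη2]) hD0.le
  have h3 : 0 ≤ η*y := mul_nonneg_of_nonpos_of_nonpos (by linarith only [hη2]) yneg
  have h4 := abs_le.mp (mulbd ηb yb)
  have h5 := abs_le.mp (mulbd ηb xb)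
  refine ⟨D2, yb, by linarith only [ha, h3], by linarith only [ha, h4.2], abs_le.mpr ⟨?_, ?_⟩⟩
  · linarith only [hc, h5.1]
  · linarith only [hc, h5.2]

theorem gate2 {b p x y D a c Er Ei R I : ℝ}
    (hb1 : 0.8195 ≤ b) (hb2 : b ≤ 0.8365) (hp1 : 0.548 ≤ p) (hp2 : p ≤ 0.573)
    (hx1 : -0.048 ≤ x) (hx2 : x ≤ 0.053) (hD0 : 0 < D) (D2 : D ≤ 0.00287)
    (yb : |y| ≤ 0.0047) (a1 : a ≤ 1) (a2 : 0.9845 ≤ a) (cb : |c| ≤ 0.172)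
    (hEr : Er = 2*b+2*x+D*(b*a+p*c)) (hEi : Ei = 2*y+D*(b*c-p*a))
    (hR : R = a*Er-c*Ei) (hI : I = a*Ei+c*Er) :
    |Ei| ≤ 0.0115 ∧ 1.639+2*x ≤ Er ∧ Er ≤ 1.6757+2*x ∧ 0.9845*Er - 0.002 ≤ R ∧ R ≤ 1.785 ∧ |I| ≤ 0.32 := by
  have Db : |D| ≤ 0.00287 := abs_le.mpr ⟨by linarith only [hD0], D2⟩
  have ab : |a| ≤ 1 := abs_le.mpr ⟨by linarith only [a2], a1⟩
  have bb : |b| ≤ 0.8365 := abs_le.mpr ⟨by linarith only [hb1], hb2⟩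
  have pb : |p| ≤ 0.573 := abs_le.mpr ⟨by linarith only [hp1], hp2⟩
  have t1 := abs_le.mp (mulbd bb cb)
  have t2 := abs_le.mp (mulbd pb ab)
  have t3 := abs_le.mp (mulbd bb ab)
  have t4 := abs_le.mp (mulbd pb cb)
  have u1 : |b*c-p*a| ≤ 0.72 := abs_le.mpr ⟨by linarith only [t1.1, t2.2], by linarith only [t1.2, t2.1]⟩
  have u2 : |b*a+p*c| ≤ 0.94 := abs_le.mpr ⟨by linarith only [t3.1, t4.1], by linarith only [t3.2, t4.2]⟩
  have v1 := abs_le.mp (mulbd Db u1)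
  have u3 : 0 ≤ b*a+p*c := by
    have : 0.8195*0.9845 ≤ b*a := mul_le_mul hb1 a2 (by norm_num) (by linarith only [hb1])
    linarith only [this, t4.1]
  have v2 : 0 ≤ D*(b*a+p*c) := by positivity
  have v3 := abs_le.mp (mulbd Db u2)
  have yb2 := abs_le.mp yb
  have Eib : |Ei| ≤ 0.0115 := by
    rw [hEi]; exact abs_le.mpr ⟨by linarith only [yb2.1, v1.1], by linarith only [yb2.2, v1.2]⟩
  have Er1 : 1.639+2*x ≤ Er := by rw [hEr]; linarith only [hb1, v2]
  have Er2 : Er ≤ 1.6757+2*x := by rw [hEr]; linarith only [hb2, v3.2]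
  have Er3 : 1.543 ≤ Er := by linarith only [Er1, hx1]
  have Er4 : Er ≤ 1.782 := by linarith only [Er2, hx2]
  have Erb : |Er| ≤ 1.782 := abs_le.mpr ⟨by linarith only [Er3], Er4⟩
  have w1 := abs_le.mp (mulbd cb Eib)
  have w2 := abs_le.mp (mulbd ab Eib)
  have w3 := abs_le.mp (mulbd cb Erb)
  refine ⟨Eib, Er1, Er2, ?_, ?_, ?_⟩
  · have : 0.9845*Er ≤ a*Er := mul_le_mul_of_nonneg_right a2 (by linarith only [Er3])
    rw [hR]; linarith only [this, w1.2]
  · have : a*Er ≤ 1*Er := mul_le_mul_of_nonneg_right a1 (by linarith only [Er3])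
    rw [hR]; linarith only [this, w1.1, Er4]
  · rw [hI]
    exact abs_le.mpr ⟨by linarith only [w2.1, w3.1], by linarith only [w2.2, w3.2]⟩

theorem gate3 {x y D R I ρ : ℝ}
    (hx1 : -0.048 ≤ x) (hx2 : x ≤ 0.053) (hD0 : 0 < D) (D2 : D ≤ 0.00287)
    (yb : |y| ≤ 0.0047) (R3 : 1.5 ≤ R) (R2 : R ≤ 1.785) (Ib : |I| ≤ 0.32)
    (hρ : ρ = 1+2*(x*R+y*I)+D*(R^2+I^2)) :
    0.82 ≤ ρ ∧ ρ ≤ 1.25 ∧ (0 ≤ x → 0.996 ≤ ρ) := by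
  have Rb : |R| ≤ 1.785 := abs_le.mpr ⟨by linarith only [R3], R2⟩
  have xb : |x| ≤ 0.053 := abs_le.mpr ⟨by linarith only [hx1], hx2⟩
  have z1 := abs_le.mp (mulbd yb Ib)
  have z2 := abs_le.mp (mulbd xb Rb)
  have Rsq := sqbd Rb
  have Isq := sqbd Ib
  have Dq : D*(R^2+I^2) ≤ 0.00287*(1.785^2+0.32^2) :=
    mul_le_mul D2 (by linarith only [Rsq, Isq]) (by positivity) (by norm_num)
  have Dq0 : 0 ≤ D*(R^2+I^2) := by positivity
  refine ⟨?_, ?_, fun hx => ?_⟩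
  · have h1 : -0.048*R ≤ x*R := mul_le_mul_of_nonneg_right hx1 (by linarith only [R3])
    rw [hρ]; linarith only [h1, R2, z1.1, Dq0]
  · rw [hρ]; linarith only [z1.2, z2.2, Dq]
  · have xR : 0 ≤ x*R := mul_nonneg hx (by linarith only [R3])
    rw [hρ]; linarith only [xR, z1.1, Dq0]

theorem gate4 {b p x η a c Er Ei R ρ F : ℝ}
    (hb1 : 0.8195 ≤ b) (hb2 : b ≤ 0.8365) (hp1 : 0.548 ≤ p) (hp2 : p ≤ 0.573)
    (hx1 : -0.048 ≤ x) (hx2 : x ≤ 0.053) (hη1 : -1.62 ≤ η) (hη2 : η ≤ -1.32)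
    (a1 : a ≤ 1) (a2 : 0.9845 ≤ a) (cb : |c| ≤ 0.172) (hc : c = 2*η*x)
    (Eib : |Ei| ≤ 0.0115) (Er1 : 1.639+2*x ≤ Er) (Er2 : Er ≤ 1.6757+2*x)
    (R1 : 0.9845*Er - 0.002 ≤ R) (ρ1 : 0.82 ≤ ρ) (ρ3 : 0 ≤ x → 0.996 ≤ ρ)
    (hF : F = 2*η+(b*c-p*a)-η*(Er^2+Ei^2)) : -0.08 ≤ F ∧ (1.03*F ≤ R*ρ) := by
  have Eisq := sqbd Eib
  have Eisq0 : 0 ≤ Ei^2 := sq_nonneg _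
  have pa1 : 0.548*0.9845 ≤ p*a := mul_le_mul hp1 a2 (by norm_num) (by linarith only [hp1])
  have pa2 : p*a ≤ 0.573*1 := mul_le_mul hp2 a1 (by linarith only [a2]) (by norm_num)
  have hF2 : F = -η*(Er^2+Ei^2-2) + b*c - p*a := by rw [hF]; ring
  have h1 : (1.32:ℝ) ≤ -η := by linarith only [hη2]
  have h2 : -η ≤ (1.62:ℝ) := by linarith only [hη1]
  have Er3 : 1.543 ≤ Er := by linarith only [Er1, hx1]
  have Er4 : Er ≤ 1.782 := by linarith only [Er2, hx2]
  have R3 : 1.5 ≤ R := by linarith only [R1, Er3]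
  have cb2 := abs_le.mp cb
  rcases le_total x 0 with hx | hx
  · have c0 : 0 ≤ c := by
      rw [hc]; exact mul_nonneg_of_nonpos_of_nonpos (by linarith only [hη2]) hx
    have bc0 : 0 ≤ b*c := mul_nonneg (by linarith only [hb1]) c0
    have c1 : (-η)*(-x) ≤ 1.62*0.048 :=
      mul_le_mul h2 (by linarith only [hx1]) (by linarith only [hx]) (by norm_num)
    have bc1 : b*c ≤ 0.8365*(1.62*2*0.048) :=
      mul_le_mul hb2 (by linarith only [hc, c1]) c0 (by norm_num)
    have e1 : 1.543^2 ≤ Er^2 := pow_le_pow_left₀ (by norm_num) Er3 2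
    have e2 : Er^2 ≤ 1.6757^2 := pow_le_pow_left₀ (by linarith only [Er3]) (by linarith only [Er2, hx]) 2
    have f1 : 1.32*(1.543^2-2) ≤ -η*(Er^2+Ei^2-2) :=
      mul_le_mul h1 (by linarith only [e1, Eisq0]) (by norm_num) (by linarith only [h1])
    have f2 : -η*(Er^2+Ei^2-2) ≤ 1.62*(1.6757^2+0.0115^2-2) :=
      mul_le_mul h2 (by linarith only [e2, Eisq]) (by linarith only [e1, Eisq0]) (by norm_num)
    have rr : 1.5*0.82 ≤ R*ρ := mul_le_mul R3 ρ1 (by norm_num) (by linarith only [R3])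
    constructor
    · rw [hF2]; linarith only [f1, bc0, pa2]
    · have : F ≤ 1.0 := by rw [hF2]; linarith only [f2, bc1, pa1]
      linarith only [this, rr]
  · have bc0 : b*c ≤ 0 := by
      have c0 : c ≤ 0 := by
        rw [hc]; exact mul_nonpos_of_nonpos_of_nonneg (by linarith only [hη2]) hx
      exact mul_nonpos_of_nonneg_of_nonpos (by linarith only [hb1]) c0
    have bc1 := abs_le.mp (mulbd (abs_le.mpr ⟨by linarith only [hb1], hb2⟩ : |b| ≤ 0.8365) cb)
    have e1 : 1.639^2 ≤ Er^2 := pow_le_pow_left₀ (by norm_num) (by linarith only [Er1, hx]) 2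
    have e2 : Er^2 ≤ 1.782^2 := pow_le_pow_left₀ (by linarith only [Er3]) Er4 2
    have f1 : 1.32*(1.639^2-2) ≤ -η*(Er^2+Ei^2-2) :=
      mul_le_mul h1 (by linarith only [e1, Eisq0]) (by norm_num) (by linarith only [h1])
    have f2 : -η*(Er^2+Ei^2-2) ≤ 1.62*(1.782^2+0.0115^2-2) :=
      mul_le_mul h2 (by linarith only [e2, Eisq]) (by linarith only [e1, Eisq0]) (by norm_num)
    have R4 : 1.61 ≤ R := by linarith only [R1, Er1, hx]
    have rr : 1.61*0.996 ≤ R*ρ := mul_le_mul R4 (ρ3 hx) (by norm_num) (by linarith only [R4])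
    constructor
    · rw [hF2]; linarith only [f1, bc1.1, pa2]
    · have : F ≤ 1.37 := by rw [hF2]; linarith only [f2, bc0, pa1]
      linarith only [this, rr]

/-- real inequalities for one passage step -/
theorem gate_real {b p s x y D η a c Er Ei R I ρ F : ℝ}
    (hb1 : 0.8195 ≤ b) (hb2 : b ≤ 0.8365) (hp1 : 0.548 ≤ p) (hp2 : p ≤ 0.573)
    (hs1 : s ≤ 1/10^11) (hx1 : -0.048 ≤ x) (hx2 : x ≤ 0.053)
    (hη1 : -1.62 ≤ η) (hη2 : η ≤ -1.32) (hD0 : 0 < D) (hD1 : D ≤ 0.004) (hy : y = η*D) (hD : D = x^2+y^2+s)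
    (ha : a = 1-2*η*y) (hc : c = 2*η*x) (hEr : Er = 2*b+2*x+D*(b*a+p*c)) (hEi : Ei = 2*y+D*(b*c-p*a))
    (hR : R = a*Er-c*Ei) (hI : I = a*Ei+c*Er) (hρ : ρ = 1+2*(x*R+y*I)+D*(R^2+I^2))
    (hF : F = 2*η+(b*c-p*a)-η*(Er^2+Ei^2)) :
    1.4 ≤ R ∧ R ≤ 1.9 ∧ 0.8 ≤ ρ ∧ ρ ≤ 1.25 ∧ D ≤ 0.00287 ∧ |y| ≤ 0.0047 ∧
    -0.1*(R*ρ) ≤ (a^2+c^2)*F ∧ (a^2+c^2)*F ≤ R*ρ := by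
  obtain ⟨D2, yb, a1, a2, cb⟩ := gate1 hs1 hx1 hx2 hη1 hη2 hD0 hD1 hy hD ha hc
  obtain ⟨Eib, Er1, Er2, R1, R2, Ib⟩ := gate2 hb1 hb2 hp1 hp2 hx1 hx2 hD0 D2 yb a1 a2 cb hEr hEi hR hI
  have R3 : 1.5 ≤ R := by linarith only [R1, Er1, hx1]
  obtain ⟨ρ1, ρ2, ρ3⟩ := gate3 hx1 hx2 hD0 D2 yb R3 R2 Ib hρ
  have key := gate4 hb1 hb2 hp1 hp2 hx1 hx2 hη1 hη2 a1 a2 cb hc Eib Er1 Er2 R1 ρ1 ρ3 hF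
  have csq := sqbd cb
  have asq := sqbd (abs_le.mpr ⟨by linarith only [a2], a1⟩ : |a| ≤ 1)
  have Q1 : a^2+c^2 ≤ 1.03 := by linarith only [asq, csq]
  have Q0 : 0 ≤ a^2+c^2 := by positivity
  have rr : 1.5*0.82 ≤ R*ρ := mul_le_mul R3 ρ1 (by norm_num) (by linarith only [R3])
  refine ⟨by linarith only [R3], by linarith only [R2], by linarith only [ρ1], ρ2, D2, yb, ?_, ?_⟩
  · have : (a^2+c^2)*(-0.08) ≤ (a^2+c^2)*F := mul_le_mul_of_nonneg_left key.1 Q0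
    linarith only [this, Q1, rr]
  · rcases le_total F 0 with h | h
    · have : (a^2+c^2)*F ≤ 0 := mul_nonpos_of_nonneg_of_nonpos Q0 h
      linarith only [this, rr]
    · exact (mul_le_mul_of_nonneg_right Q1 h).trans key.2

end Tri
end

/-! ### Part 7 : the clamped orbit -/

noncomputable section

namespace Tri

/-- second iterate -/
def ff (B : ℂ) (s : ℝ) (w : ℂ) : ℂ := gB B s (gB B s w)

theorem ff_re (b p s : ℝ) (hbp : b^2+p^2=1) (w : ℂ) :
    (ff ⟨b,p⟩ s w).re = w.re + ((w.re^2-w.im^2+s)*(2*b+2*w.re+b*(w.re^2-w.im^2+s)+p*(2*w.re*w.im))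
      - (2*w.re*w.im)*(2*w.im + b*(2*w.re*w.im) - p*(w.re^2-w.im^2+s))) := by
  simp only [ff, gB, pow_two, Complex.add_re, Complex.mul_re, Complex.conj_re, Complex.conj_im,
    Complex.add_im, Complex.mul_im, Complex.ofReal_re, Complex.ofReal_im]
  have h : p^2 = 1-b^2 := by linarith
  linear_combination (exp := 1) (b * (w.re^2-w.im^2+s)^2 - b*(2*w.re*w.im)^2 + (w.re^2-w.im^2+s)*w.re*2 - 4*w.re*w.im^2 + 2*p*(2*w.re*w.im)*(w.re^2-w.im^2+s)) * hbp

theorem ff_im (b p s : ℝ) (hbp : b^2+p^2=1) (w : ℂ) :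
    (ff ⟨b,p⟩ s w).im = w.im + ((w.re^2-w.im^2+s)*(2*w.im + b*(2*w.re*w.im) - p*(w.re^2-w.im^2+s))
      + (2*w.re*w.im)*(2*b+2*w.re+b*(w.re^2-w.im^2+s)+p*(2*w.re*w.im))) := by
  simp only [ff, gB, pow_two, Complex.add_re, Complex.mul_re, Complex.conj_re, Complex.conj_im,
    Complex.add_im, Complex.mul_im, Complex.ofReal_re, Complex.ofReal_im]
  linear_combination (exp := 1) (-p * (w.re^2-w.im^2+s)^2 + p*(2*w.re*w.im)^2 + (w.re^2-w.im^2+s)*w.im*2 + 4*w.re^2*w.im + 2*b*(2*w.re*w.im)*(w.re^2-w.im^2+s)) * hbp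

theorem gate_step {b p s : ℝ} {w : ℂ} (hbp : b^2+p^2=1)
    (hb1 : 0.8195 ≤ b) (hb2 : b ≤ 0.8365) (hp1 : 0.548 ≤ p) (hp2 : p ≤ 0.573)
    (hs1 : s ≤ 1/10^11) (hx1 : -0.048 ≤ w.re) (hx2 : w.re ≤ 0.053)
    (hη1 : -1.62 ≤ eta s w) (hη2 : eta s w ≤ -1.32) (hD0 : 0 < DD s w) (hD1 : DD s w ≤ 0.004) :
    1.4 * DD s w ≤ (ff ⟨b,p⟩ s w).re - w.re ∧ (ff ⟨b,p⟩ s w).re - w.re ≤ 1.9 * DD s w ∧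
    0.8 * DD s w ≤ DD s (ff ⟨b,p⟩ s w) ∧ DD s (ff ⟨b,p⟩ s w) ≤ 0.004 ∧
    DD s w ≤ 0.00287 ∧ |w.im| ≤ 0.0047 ∧
    -0.1 * ((ff ⟨b,p⟩ s w).re - w.re) ≤ eta s (ff ⟨b,p⟩ s w) - eta s w ∧
    eta s (ff ⟨b,p⟩ s w) - eta s w ≤ (ff ⟨b,p⟩ s w).re - w.re := by
  have hy : w.im = eta s w * DD s w := by rw [eta, div_mul_cancel₀ _ hD0.ne']
  obtain ⟨D, hDe⟩ : ∃ D, D = DD s w := ⟨_, rfl⟩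
  obtain ⟨η, hηe⟩ : ∃ η, η = eta s w := ⟨_, rfl⟩
  obtain ⟨x, hxe⟩ : ∃ x, x = w.re := ⟨_, rfl⟩
  obtain ⟨y, hye⟩ : ∃ y, y = w.im := ⟨_, rfl⟩
  have h1 := ff_re b p s hbp w
  have h2 := ff_im b p s hbp w
  have hD : D = x^2+y^2+s := by rw [hDe, hxe, hye, DD]
  rw [← hDe] at hy hD0 hD1 ⊢
  rw [← hηe] at hy hη1 hη2 ⊢
  rw [← hxe] at hx1 hx2 h1 h2 ⊢
  rw [← hye] at hy h1 h2 ⊢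
  obtain ⟨a, ha⟩ : ∃ a, a = 1-2*η*y := ⟨_, rfl⟩
  obtain ⟨c, hc⟩ : ∃ c, c = 2*η*x := ⟨_, rfl⟩
  obtain ⟨Er, hEr⟩ : ∃ Er, Er = 2*b+2*x+D*(b*a+p*c) := ⟨_, rfl⟩
  obtain ⟨Ei, hEi⟩ : ∃ Ei, Ei = 2*y+D*(b*c-p*a) := ⟨_, rfl⟩
  obtain ⟨R, hR⟩ : ∃ R, R = a*Er-c*Ei := ⟨_, rfl⟩
  obtain ⟨I, hI⟩ : ∃ I, I = a*Ei+c*Er := ⟨_, rfl⟩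
  obtain ⟨ρ, hρ⟩ : ∃ ρ, ρ = 1+2*(x*R+y*I)+D*(R^2+I^2) := ⟨_, rfl⟩
  obtain ⟨F, hF⟩ : ∃ F, F = 2*η+(b*c-p*a)-η*(Er^2+Ei^2) := ⟨_, rfl⟩
  obtain ⟨g1, g2, g3, g4, g5, g6, g7, g8⟩ :=
    gate_real hb1 hb2 hp1 hp2 hs1 hx1 hx2 hη1 hη2 hD0 hD1 hy hD ha hc hEr hEi hR hI hρ hF
  have P1 : x^2-y^2+s = D*a := by
    rw [ha]; linear_combination (-1)*hD - 2*y*hy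
  have P2 : 2*x*y = D*c := by rw [hc]; linear_combination 2*x*hy
  rw [P1, P2] at h1 h2
  have h3 : (ff ⟨b,p⟩ s w).re = x + D*R := by
    rw [h1, hR, hEr, hEi]; ring
  have h4 : (ff ⟨b,p⟩ s w).im = y + D*I := by
    rw [h2, hI, hEr, hEi]; ring
  have h5 : DD s (ff ⟨b,p⟩ s w) = D*ρ := by
    rw [DD, h3, h4, hρ]; linear_combination (-1)*hD
  have hρ0 : 0 < ρ := by linarith only [g3]
  have h6 : (eta s (ff ⟨b,p⟩ s w) - η) = D*((a^2+c^2)*F)/ρ := by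
    have hI2 : y + D*I = D*(η+I) := by linear_combination hy
    rw [eta, h5, h4, hI2, mul_div_mul_left _ _ hD0.ne', div_sub' hρ0.ne']
    congr 1
    have e1 : I - 2*η*(x*R+y*I) = (a^2+c^2)*Ei := by
      rw [hR, hI]
      linear_combination (-(a*Ei+c*Er))*ha + (a*Er-c*Ei)*hc
    have e2 : R^2+I^2 = (a^2+c^2)*(Er^2+Ei^2) := by rw [hR, hI]; ring
    have e3 : Ei = D*(2*η + (b*c-p*a)) := by rw [hEi]; linear_combination 2*hy
    rw [hρ, hF]
    linear_combination e1 - η*D*e2 + (a^2+c^2)*e3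
  have h7 : (ff ⟨b,p⟩ s w).re - x = D*R := by rw [h3]; ring
  rw [h7, h6, h5, le_div_iff₀ hρ0, div_le_iff₀ hρ0]
  refine ⟨?_, ?_, ?_, ?_, g5, g6, ?_, ?_⟩
  · nlinarith only [mul_le_mul_of_nonneg_left g1 hD0.le]
  · nlinarith only [mul_le_mul_of_nonneg_left g2 hD0.le]
  · nlinarith only [mul_le_mul_of_nonneg_left g3 hD0.le]
  · nlinarith only [mul_le_mul_of_nonneg_left g4 hD0.le, g5]
  · nlinarith only [mul_le_mul_of_nonneg_left g7 hD0.le]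
  · nlinarith only [mul_le_mul_of_nonneg_left g8 hD0.le]

/-- denominator of clamping factor -/
def stD (B : ℂ) (s : ℝ) (w : ℂ) : ℝ := max ((ff B s w).re - w.re) (1.4 * DD s w)

def stX (B : ℂ) (s : ℝ) (w : ℂ) : ℝ := min 1 ((0.053 - w.re) / stD B s w)

def stH (B : ℂ) (s : ℝ) (w : ℂ) : ℝ :=
  (ff B s w).im / max (DD s (ff B s w)) (0.8 * DD s w) - eta s w

/-- clamped step -/
def stp (B : ℂ) (s : ℝ) (v : ℂ × ℝ) : ℂ × ℝ :=
  (v.1 + (stX B s v.1 : ℂ) * (ff B s v.1 - v.1), v.2 + stX B s v.1 * stH B s v.1)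

def orb (B : ℂ) (s : ℝ) (W : ℂ) (n : ℕ) : ℂ × ℝ := (stp B s)^[n] (W, eta s W)

theorem orb_succ (B : ℂ) (s : ℝ) (W : ℂ) (n : ℕ) : orb B s W (n+1) = stp B s (orb B s W n) := by
  rw [orb, orb, Function.iterate_succ_apply']

/-- the invariant -/
def Inv (B : ℂ) (s : ℝ) (W : ℂ) (n : ℕ) (v : ℂ × ℝ) : Prop :=
  W.re ≤ v.1.re ∧ -0.1 * (v.1.re - W.re) ≤ v.2 - eta s W ∧ v.2 - eta s W ≤ v.1.re - W.re ∧
  (v.1.re = 0.053 ∨ (v.1.re < 0.053 ∧ v.2 = eta s v.1 ∧ 0 < DD s v.1 ∧ DD s v.1 ≤ 0.004 ∧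
    v.1 = (ff B s)^[n] W ∧ W.re + 1.4 * s * n ≤ v.1.re))

theorem inv_zero {B : ℂ} {s : ℝ} {W : ℂ} (hs0 : 0 ≤ s) (hs1 : s ≤ 1/10^11)
    (h1 : -0.048 ≤ W.re) (h2 : W.re ≤ -0.046)
    (h3 : -0.005 ≤ W.im) (h4 : W.im ≤ 0) : Inv B s W 0 (orb B s W 0) := by
  have e1 : 0.046^2 ≤ W.re^2 := by nlinarith
  have e2 : W.re^2 ≤ 0.048^2 := by nlinarith
  have e3 : W.im^2 ≤ 0.005^2 := by nlinarith
  have e4 := sq_nonneg W.im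
  have ho : orb B s W 0 = (W, eta s W) := rfl
  rw [ho, Inv]
  refine ⟨le_rfl, by simp, by simp, Or.inr ⟨by linarith, rfl, ?_, ?_, rfl, by simp⟩⟩
  · rw [DD]; linarith
  · rw [DD]; norm_num at *; linarith

theorem step_cases {b p s : ℝ} {W : ℂ} (hbp : b^2+p^2=1)
    (hb1 : 0.8195 ≤ b) (hb2 : b ≤ 0.8365) (hp1 : 0.548 ≤ p) (hp2 : p ≤ 0.573)
    (hs1 : s ≤ 1/10^11)
    (h1 : -0.048 ≤ W.re) (h5 : -1.605 ≤ eta s W) (h6 : eta s W ≤ -1.425)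
    {n : ℕ} {v : ℂ × ℝ} (hv : Inv ⟨b,p⟩ s W n v) :
    (v.1.re = 0.053 ∧ stp ⟨b,p⟩ s v = v) ∨ (v.1.re < 0.053 ∧ v.2 = eta s v.1 ∧ 0 < DD s v.1 ∧
     DD s v.1 ≤ 0.00287 ∧ |v.1.im| ≤ 0.0047 ∧ v.1 = (ff ⟨b,p⟩ s)^[n] W ∧
     -1.62 ≤ eta s v.1 ∧ eta s v.1 ≤ -1.32 ∧
     1.4 * DD s v.1 ≤ (ff ⟨b,p⟩ s v.1).re - v.1.re ∧ (ff ⟨b,p⟩ s v.1).re - v.1.re ≤ 1.9 * DD s v.1 ∧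
     0.8 * DD s v.1 ≤ DD s (ff ⟨b,p⟩ s v.1) ∧ DD s (ff ⟨b,p⟩ s v.1) ≤ 0.004 ∧
     -0.1 * ((ff ⟨b,p⟩ s v.1).re - v.1.re) ≤ eta s (ff ⟨b,p⟩ s v.1) - eta s v.1 ∧
     eta s (ff ⟨b,p⟩ s v.1) - eta s v.1 ≤ (ff ⟨b,p⟩ s v.1).re - v.1.re ∧
     stD ⟨b,p⟩ s v.1 = (ff ⟨b,p⟩ s v.1).re - v.1.re ∧
     stH ⟨b,p⟩ s v.1 = eta s (ff ⟨b,p⟩ s v.1) - eta s v.1) := by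
  obtain ⟨i1, i2, i3, i4⟩ := hv
  rcases i4 with h | ⟨j1, j2, j3, j4, j5, j6⟩
  · left
    refine ⟨h, ?_⟩
    simp [stp, stX, h]
  · right
    have hη1 : -1.62 ≤ eta s v.1 := by rw [← j2]; norm_num at *; linarith
    have hη2 : eta s v.1 ≤ -1.32 := by rw [← j2]; norm_num at *; linarith
    obtain ⟨g1, g2, g3, g4, g5, g6, g7, g8⟩ :=
      gate_step hbp hb1 hb2 hp1 hp2 hs1 (h1.trans i1) j1.le hη1 hη2 j3 j4
    refine ⟨j1, j2, j3, g5, g6, j5, hη1, hη2, g1, g2, g3, g4, g7, g8, ?_, ?_⟩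
    · rw [stD, max_eq_left g1]
    · rw [stH, max_eq_left g3]; rfl

theorem inv_succ {b p s : ℝ} {W : ℂ} (hbp : b^2+p^2=1)
    (hb1 : 0.8195 ≤ b) (hb2 : b ≤ 0.8365) (hp1 : 0.548 ≤ p) (hp2 : p ≤ 0.573)
    (hs1 : s ≤ 1/10^11)
    (h1 : -0.048 ≤ W.re) (h5 : -1.605 ≤ eta s W) (h6 : eta s W ≤ -1.425)
    {n : ℕ} {v : ℂ × ℝ} (hv : Inv ⟨b,p⟩ s W n v) :
    Inv ⟨b,p⟩ s W (n+1) (stp ⟨b,p⟩ s v) := by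
  rcases step_cases hbp hb1 hb2 hp1 hp2 hs1 h1 h5 h6 hv with
    ⟨h, h'⟩ | ⟨j1, j2, j3, k1, k2, j5, k3, k4, g1, g2, g3, g4, g7, g8, d1, d2⟩
  · rw [h']; exact ⟨hv.1, hv.2.1, hv.2.2.1, Or.inl h⟩
  obtain ⟨i1, i2, i3, i4⟩ := hv
  obtain ⟨Δ, hΔ⟩ : ∃ Δ, Δ = (ff ⟨b,p⟩ s v.1).re - v.1.re := ⟨_, rfl⟩
  have hΔ0 : 0 < Δ := by rw [hΔ]; linarith only [g1, j3]
  obtain ⟨χ, hχ⟩ : ∃ χ, χ = stX ⟨b,p⟩ s v.1 := ⟨_, rfl⟩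
  have hχ' : χ = min 1 ((0.053 - v.1.re)/Δ) := by rw [hχ, stX, d1, hΔ]
  have hχ0 : 0 ≤ χ := by
    rw [hχ']; exact le_min zero_le_one (div_nonneg (by linarith only [j1]) hΔ0.le)
  have hre : (stp ⟨b,p⟩ s v).1.re = v.1.re + χ * Δ := by
    simp [stp, ← hχ, hΔ]
  have hh : (stp ⟨b,p⟩ s v).2 = v.2 + χ * (eta s (ff ⟨b,p⟩ s v.1) - eta s v.1) := by
    simp [stp, ← hχ, d2]
  have m1 := mul_le_mul_of_nonneg_left g7 hχ0
  have m2 := mul_le_mul_of_nonneg_left g8 hχ0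
  rw [← hΔ] at m1 m2
  have m3 : 0 ≤ χ * Δ := mul_nonneg hχ0 hΔ0.le
  refine ⟨?_, ?_, ?_, ?_⟩
  · rw [hre]; linarith only [i1, m3]
  · rw [hre, hh]; linarith only [i2, m1]
  · rw [hre, hh]; linarith only [i3, m2]
  rcases le_or_gt ((0.053 - v.1.re)/Δ) 1 with hc | hc
  · left
    rw [hre, hχ', min_eq_right hc, div_mul_cancel₀ _ hΔ0.ne']; ring
  · right
    have hχ1 : χ = 1 := by rw [hχ', min_eq_left hc.le]
    have hst : (stp ⟨b,p⟩ s v).1 = ff ⟨b,p⟩ s v.1 := by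
      simp [stp, ← hχ, hχ1]
    have hst2 : (stp ⟨b,p⟩ s v).2 = eta s (ff ⟨b,p⟩ s v.1) := by
      rw [hh, hχ1, j2]; ring
    rw [hst, hst2]
    rw [lt_div_iff₀ hΔ0] at hc
    refine ⟨by linarith only [hc, hΔ], rfl, by linarith only [g3, j3], g4, ?_, ?_⟩
    · rw [Function.iterate_succ_apply', ← j5]
    · rcases i4 with h | ⟨-, -, -, -, -, j6⟩
      · linarith only [h, j1]
      · have : s ≤ DD s v.1 := by rw [DD]; linarith only [sq_nonneg v.1.re, sq_nonneg v.1.im]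
        push_cast
        linarith only [j6, g1, this]

theorem inv_all {b p s : ℝ} {W : ℂ} (hbp : b^2+p^2=1)
    (hb1 : 0.8195 ≤ b) (hb2 : b ≤ 0.8365) (hp1 : 0.548 ≤ p) (hp2 : p ≤ 0.573)
    (hs0 : 0 ≤ s) (hs1 : s ≤ 1/10^11)
    (h1 : -0.048 ≤ W.re) (h2 : W.re ≤ -0.046) (h3 : -0.005 ≤ W.im) (h4 : W.im ≤ 0)
    (h5 : -1.605 ≤ eta s W) (h6 : eta s W ≤ -1.425) (n : ℕ) :
    Inv ⟨b,p⟩ s W n (orb ⟨b,p⟩ s W n) := by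
  induction n with
  | zero => exact inv_zero hs0 hs1 h1 h2 h3 h4
  | succ k ih =>
    rw [orb_succ]
    exact inv_succ hbp hb1 hb2 hp1 hp2 hs1 h1 h5 h6 ih

/-- at `s = 0` the orbit never passes -/
theorem inv_neg {b p : ℝ} {W : ℂ} (hbp : b^2+p^2=1)
    (hb1 : 0.8195 ≤ b) (hb2 : b ≤ 0.8365) (hp1 : 0.548 ≤ p) (hp2 : p ≤ 0.573)
    (h1 : -0.048 ≤ W.re) (h2 : W.re ≤ -0.046) (h3 : -0.005 ≤ W.im) (h4 : W.im ≤ 0)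
    (h5 : -1.605 ≤ eta 0 W) (h6 : eta 0 W ≤ -1.425) (n : ℕ) :
    (orb ⟨b,p⟩ 0 W n).1.re < 0 := by
  have hs1 : (0:ℝ) ≤ 1/10^11 := by norm_num
  induction n with
  | zero => simp only [orb, Function.iterate_zero, id]; linarith only [h2]
  | succ k ih =>
    have hv := inv_all hbp hb1 hb2 hp1 hp2 le_rfl hs1 h1 h2 h3 h4 h5 h6 k
    rw [orb_succ]
    rcases step_cases hbp hb1 hb2 hp1 hp2 hs1 h1 h5 h6 hv with
      ⟨h, h'⟩ | ⟨j1, j2, j3, k1, k2, j5, k3, k4, g1, g2, g3, g4, g7, g8, d1, d2⟩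
    · rw [h']; exact ih
    obtain ⟨i1, -, -, -⟩ := hv
    set v := orb ⟨b,p⟩ 0 W k
    have hX1 : stX ⟨b,p⟩ 0 v.1 ≤ 1 := min_le_left _ _
    have hre : (stp ⟨b,p⟩ 0 v).1.re = v.1.re + stX ⟨b,p⟩ 0 v.1 * ((ff ⟨b,p⟩ 0 v.1).re - v.1.re) := by
      simp [stp]
    have hm : stX ⟨b,p⟩ 0 v.1 * ((ff ⟨b,p⟩ 0 v.1).re - v.1.re) ≤ 1 * ((ff ⟨b,p⟩ 0 v.1).re - v.1.re) :=
      mul_le_mul_of_nonneg_right hX1 (by linarith only [g1, j3])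
    have hy : v.1.im = eta 0 v.1 * DD 0 v.1 := by rw [eta, div_mul_cancel₀ _ j3.ne']
    have hD : DD 0 v.1 = v.1.re^2 + v.1.im^2 := by rw [DD]; ring
    have hy2 : |v.1.im| ≤ 1.62 * DD 0 v.1 := by
      rw [hy, abs_mul, abs_of_pos j3]
      exact mul_le_mul_of_nonneg_right (abs_le.mpr ⟨k3, by linarith only [k4]⟩) j3.le
    have hy3 : v.1.im^2 ≤ 0.0047 * (1.62 * DD 0 v.1) := by
      rw [← sq_abs, sq]
      exact mul_le_mul k2 hy2 (abs_nonneg _) (by norm_num)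
    have hx3 : v.1.re^2 ≤ 0.048 * (-v.1.re) := by
      have : (-v.1.re)*(-v.1.re) ≤ 0.048 * (-v.1.re) :=
        mul_le_mul_of_nonneg_right (by linarith only [i1, h1]) (by linarith only [ih])
      linarith only [this]
    rw [hre]
    linarith only [hm, g2, hD, hy3, hx3, ih]

theorem inv_end {B : ℂ} {s : ℝ} {W : ℂ} {n : ℕ} {v : ℂ × ℝ} (h1 : -0.048 ≤ W.re)
    (hn : 0.101 < 1.4 * s * n) (hv : Inv B s W n v) : v.1.re = 0.053 := by
  rcases hv.2.2.2 with h | h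
  · exact h
  · have a := h.2.2.2.2.2
    have b := h.1
    linarith only [a, b, hn, h1]

/-! continuity -/

theorem cont_ff {X : Type*} [TopologicalSpace X] {K : Set X} {B w : X → ℂ} {s : X → ℝ}
    (hB : ContinuousOn B K) (hs : ContinuousOn s K) (hw : ContinuousOn w K) :
    ContinuousOn (fun q => ff (B q) (s q) (w q)) K := by
  have hs' : ContinuousOn (fun q => (s q : ℂ)) K := Complex.continuous_ofReal.comp_continuousOn hs
  have hg : ∀ u : X → ℂ, ContinuousOn u K → ContinuousOn (fun q => gB (B q) (s q) (u q)) K := by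
    intro u hu
    have hc : ContinuousOn (fun q => starRingEnd ℂ (u q)) K := Complex.continuous_conj.comp_continuousOn hu
    exact hc.add (hB.mul ((hc.pow 2).add hs'))
  exact hg _ (hg _ hw)

theorem cont_DD {X : Type*} [TopologicalSpace X] {K : Set X} {w : X → ℂ} {s : X → ℝ}
    (hs : ContinuousOn s K) (hw : ContinuousOn w K) :
    ContinuousOn (fun q => DD (s q) (w q)) K := by
  have h1 : ContinuousOn (fun q => (w q).re) K := Complex.continuous_re.comp_continuousOn hw
  have h2 : ContinuousOn (fun q => (w q).im) K := Complex.continuous_im.comp_continuousOn hw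
  exact ((h1.pow 2).add (h2.pow 2)).add hs

theorem cont_eta {X : Type*} [TopologicalSpace X] {K : Set X} {w : X → ℂ} {s : X → ℝ}
    (hs : ContinuousOn s K) (hw : ContinuousOn w K) (h0 : ∀ q ∈ K, 0 < DD (s q) (w q)) :
    ContinuousOn (fun q => eta (s q) (w q)) K := by
  have h2 : ContinuousOn (fun q => (w q).im) K := Complex.continuous_im.comp_continuousOn hw
  exact h2.div (cont_DD hs hw) (fun q hq => (h0 q hq).ne')

theorem cont_stp {X : Type*} [TopologicalSpace X] {K : Set X} {B : X → ℂ} {v : X → ℂ × ℝ} {s : X → ℝ}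
    (hB : ContinuousOn B K) (hs : ContinuousOn s K) (hv : ContinuousOn v K)
    (h0 : ∀ q ∈ K, 0 < DD (s q) (v q).1) :
    ContinuousOn (fun q => stp (B q) (s q) (v q)) K := by
  have hw : ContinuousOn (fun q => (v q).1) K := continuous_fst.comp_continuousOn hv
  have hh : ContinuousOn (fun q => (v q).2) K := continuous_snd.comp_continuousOn hv
  have hf := cont_ff hB hs hw
  have hD := cont_DD hs hw
  have hDf := cont_DD hs hf
  have hη := cont_eta hs hw h0
  have hwr : ContinuousOn (fun q => ((v q).1).re) K := Complex.continuous_re.comp_continuousOn hw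
  have hfr := Complex.continuous_re.comp_continuousOn hf
  have hfi := Complex.continuous_im.comp_continuousOn hf
  have hd : ContinuousOn (fun q => stD (B q) (s q) (v q).1) K :=
    (hfr.sub hwr).sup (hD.const_smul (1.4:ℝ))
  have hd0 : ∀ q ∈ K, stD (B q) (s q) (v q).1 ≠ 0 := by
    intro q hq
    have : 1.4 * DD (s q) (v q).1 ≤ stD (B q) (s q) (v q).1 := le_max_right _ _
    have := h0 q hq
    intro h; linarith
  have hX : ContinuousOn (fun q => stX (B q) (s q) (v q).1) K :=
    continuousOn_const.inf ((continuousOn_const.sub hwr).div hd hd0)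
  have hH : ContinuousOn (fun q => stH (B q) (s q) (v q).1) K := by
    refine (hfi.div (hDf.sup (hD.const_smul (0.8:ℝ))) ?_).sub hη
    intro q hq h
    have h1 : 0.8 * DD (s q) (v q).1 ≤ max (DD (s q) (ff (B q) (s q) (v q).1)) ((0.8:ℝ) • DD (s q) (v q).1) := le_max_right _ _
    have := h0 q hq
    have h2 := h1.trans_eq h
    linarith
  have hX' : ContinuousOn (fun q => (stX (B q) (s q) (v q).1 : ℂ)) K := Complex.continuous_ofReal.comp_continuousOn hX
  exact (hw.add (hX'.mul (hf.sub hw))).prodMk (hh.add (hX.mul hH))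

theorem inv_pos {B : ℂ} {s : ℝ} {W : ℂ} {n : ℕ} {v : ℂ × ℝ} (hs0 : 0 ≤ s)
    (hv : Inv B s W n v) : 0 < DD s v.1 := by
  rcases hv.2.2.2 with h | h
  · rw [DD, h]; have := sq_nonneg v.1.im; norm_num; linarith
  · exact h.2.2.1

theorem cont_orb {X : Type*} [TopologicalSpace X] {K : Set X} {B W : X → ℂ} {s : X → ℝ}
    (hB : ContinuousOn B K) (hs : ContinuousOn s K) (hW : ContinuousOn W K)
    (hs0 : ∀ q ∈ K, 0 ≤ s q)
    (hI : ∀ q ∈ K, ∀ n, Inv (B q) (s q) (W q) n (orb (B q) (s q) (W q) n)) (n : ℕ) :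
    ContinuousOn (fun q => orb (B q) (s q) (W q) n) K := by
  induction n with
  | zero =>
    exact hW.prodMk (cont_eta hs hW (fun q hq => inv_pos (hs0 q hq) (hI q hq 0)))
  | succ k ih =>
    simp only [orb_succ]
    exact cont_stp hB hs ih (fun q hq => inv_pos (hs0 q hq) (hI q hq k))

end Tri
end

/-! ### Part 8 : a two dimensional intermediate value theorem -/

noncomputable section

namespace Tri

theorem arc_stay {θ : ℝ → ℝ} (hθ : Continuous θ) {a b α : ℝ} (hab : a ≤ b)
    (h0 : ∀ t ∈ Set.Icc a b, 0 < Real.cos (θ t - α)) {t0 t1 : ℝ} (ht0 : t0 ∈ Set.Icc a b)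
    (ht1 : t1 ∈ Set.Icc a b)
    (hs1 : α - Real.pi/2 < θ t0) (hs2 : θ t0 < α + Real.pi/2) :
    α - Real.pi/2 < θ t1 ∧ θ t1 < α + Real.pi/2 := by
  have hc : IsPreconnected (θ '' Set.Icc a b) := isPreconnected_Icc.image _ hθ.continuousOn
  have ho := hc.ordConnected
  have m0 : θ t0 ∈ θ '' Set.Icc a b := ⟨t0, ht0, rfl⟩
  have m1 : θ t1 ∈ θ '' Set.Icc a b := ⟨t1, ht1, rfl⟩
  constructor
  · by_contra hcon
    push Not at hcon
    obtain ⟨t, ht, hte⟩ := ho.out m1 m0 ⟨hcon, hs1.le⟩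
    have := h0 t ht
    rw [hte, show α - Real.pi/2 - α = -(Real.pi/2) by ring, Real.cos_neg, Real.cos_pi_div_two] at this
    exact lt_irrefl _ this
  · by_contra hcon
    push Not at hcon
    obtain ⟨t, ht, hte⟩ := ho.out m0 m1 ⟨hs2.le, hcon⟩
    have := h0 t ht
    rw [hte, show α + Real.pi/2 - α = (Real.pi/2) by ring, Real.cos_pi_div_two] at this
    exact lt_irrefl _ this

theorem PM_global {F : ℝ × ℝ → ℂ} (hF : Continuous F) {a b c d : ℝ} (hab : a ≤ b) (hcd : c ≤ d)
    (hl : ∀ t ∈ Set.Icc c d, 0 < (F (a, t)).re) (hr : ∀ t ∈ Set.Icc c d, (F (b, t)).re < 0)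
    (hd : ∀ t ∈ Set.Icc a b, (F (t, c)).im < 0) (hu : ∀ t ∈ Set.Icc a b, 0 < (F (t, d)).im) :
    ∃ q, F q = 0 := by
  by_contra hcon
  push Not at hcon
  obtain ⟨L, ⟨hL0, hL⟩, -⟩ := Complex.isCoveringMapOn_exp.existsUnique_continuousMap_lifts
    ⟨F, hF⟩ (a₀ := (a, c)) (e₀ := Complex.log (F (a, c))) (Complex.exp_log (hcon _)) (fun x => hcon x)
  have hL' : ∀ q, F q = Complex.exp (L q) := fun q => (congrFun hL q).symm
  have hre : ∀ q, (F q).re = Real.exp (L q).re * Real.cos (L q).im := fun q => by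
    rw [hL' q, Complex.exp_re]
  have him : ∀ q, (F q).im = Real.exp (L q).re * Real.sin (L q).im := fun q => by
    rw [hL' q, Complex.exp_im]
  have hc : Continuous fun q => (L q).im := Complex.continuous_im.comp L.continuous
  have ca : a ∈ Set.Icc a b := ⟨le_rfl, hab⟩
  have cb : b ∈ Set.Icc a b := ⟨hab, le_rfl⟩
  have cc : c ∈ Set.Icc c d := ⟨le_rfl, hcd⟩
  have cd : d ∈ Set.Icc c d := ⟨hcd, le_rfl⟩
  have hpi := Real.pi_pos
  have s0 : (L (a,c)).im ∈ Set.Ioo (-(Real.pi/2)) 0 := by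
    rw [hL0, Complex.log_im]
    have h1 := Complex.abs_arg_lt_pi_div_two_iff.mpr (Or.inl (hl c cc))
    have h2 := Complex.arg_neg_iff.mpr (hd a ca)
    exact ⟨(abs_lt.mp h1).1, h2⟩
  -- left side
  have s1 := arc_stay (θ := fun t => (L (a,t)).im) (α := 0) (hc.comp (by fun_prop)) hcd (by
    intro t ht
    have := hl t ht
    rw [hre] at this
    simpa using pos_of_mul_pos_right this (Real.exp_pos _).le) cc cd
    (by simpa using s0.1) (by simpa using (lt_trans s0.2 (by positivity) : (L (a,c)).im < Real.pi/2))
  have s1' : 0 < (L (a,d)).im := by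
    by_contra h
    push Not at h
    have h2 := hu a ca
    rw [him] at h2
    have := pos_of_mul_pos_right h2 (Real.exp_pos _).le
    have h3 := Real.sin_nonpos_of_nonpos_of_neg_pi_le h (by have := s1.1; linarith)
    linarith
  simp only [zero_add] at s1
  -- top side
  have s2 := arc_stay (θ := fun t => (L (t,d)).im) (α := Real.pi/2) (hc.comp (by fun_prop)) hab (by
    intro t ht
    have := hu t ht
    rw [him] at this
    rw [Real.cos_sub_pi_div_two]
    exact pos_of_mul_pos_right this (Real.exp_pos _).le) ca cb
    (by simpa using s1') (by linarith [s1.2])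
  have s2' : Real.pi/2 < (L (b,d)).im := by
    by_contra h
    push Not at h
    have h2 := hr d cd
    rw [hre] at h2
    have h3 := Real.cos_nonneg_of_neg_pi_div_two_le_of_le (by linarith [s2.1]) h
    have := mul_nonneg (Real.exp_pos (L (b,d)).re).le h3
    linarith
  -- right side
  have s3 := arc_stay (θ := fun t => (L (b,t)).im) (α := Real.pi) (hc.comp (by fun_prop)) hcd (by
    intro t ht
    have := hr t ht
    rw [hre] at this
    rw [Real.cos_sub_pi]
    have h3 := neg_of_mul_neg_right this (Real.exp_pos _).le
    linarith) cd cc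
    (by linarith) (by linarith [s2.2])
  have s3' : Real.pi < (L (b,c)).im := by
    by_contra h
    push Not at h
    have h2 := hd b cb
    rw [him] at h2
    have h3 := Real.sin_nonneg_of_nonneg_of_le_pi (by linarith [s3.1]) h
    have := mul_nonneg (Real.exp_pos (L (b,c)).re).le h3
    linarith
  have s4 := arc_stay (θ := fun t => (L (t,c)).im) (α := Real.pi + Real.pi/2) (hc.comp (by fun_prop)) hab (by
    intro t ht
    have := hd t ht
    rw [him] at this
    rw [← sub_sub, Real.cos_sub_pi_div_two, Real.sin_sub_pi]
    have h3 := neg_of_mul_neg_right this (Real.exp_pos _).le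
    linarith) cb ca
    (by linarith) (by linarith [s3.2])
  linarith [s4.1, s0.2]

theorem PM {u v : ℝ × ℝ → ℝ} {a b c d : ℝ} (hab : a ≤ b) (hcd : c ≤ d)
    (hu : ContinuousOn u (Set.Icc a b ×ˢ Set.Icc c d)) (hv : ContinuousOn v (Set.Icc a b ×ˢ Set.Icc c d))
    (hl : ∀ t ∈ Set.Icc c d, 0 < u (a, t)) (hr : ∀ t ∈ Set.Icc c d, u (b, t) < 0)
    (hd : ∀ t ∈ Set.Icc a b, v (t, c) < 0) (hup : ∀ t ∈ Set.Icc a b, 0 < v (t, d)) :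
    ∃ q ∈ Set.Icc a b ×ˢ Set.Icc c d, u q = 0 ∧ v q = 0 := by
  have hπ : Continuous fun q : ℝ × ℝ => ((max a (min b q.1), max c (min d q.2)) : ℝ × ℝ) := by fun_prop
  have hm : ∀ q : ℝ × ℝ, ((max a (min b q.1), max c (min d q.2)) : ℝ × ℝ) ∈ Set.Icc a b ×ˢ Set.Icc c d := by
    intro q
    exact ⟨⟨le_max_left _ _, max_le hab (min_le_left _ _)⟩, ⟨le_max_left _ _, max_le hcd (min_le_left _ _)⟩⟩
  have e1 : ∀ t ∈ Set.Icc a b, max a (min b t) = t := fun t ht => by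
    rw [min_eq_right ht.2, max_eq_right ht.1]
  have e2 : ∀ t ∈ Set.Icc c d, max c (min d t) = t := fun t ht => by
    rw [min_eq_right ht.2, max_eq_right ht.1]
  have ca : a ∈ Set.Icc a b := ⟨le_rfl, hab⟩
  have cb : b ∈ Set.Icc a b := ⟨hab, le_rfl⟩
  have cc : c ∈ Set.Icc c d := ⟨le_rfl, hcd⟩
  have cd : d ∈ Set.Icc c d := ⟨hcd, le_rfl⟩
  have hu' := hu.comp_continuous hπ hm
  have hv' := hv.comp_continuous hπ hm
  have hF : Continuous fun q : ℝ × ℝ =>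
      (⟨u (max a (min b q.1), max c (min d q.2)), v (max a (min b q.1), max c (min d q.2))⟩ : ℂ) := by
    have := (Complex.continuous_ofReal.comp hu').add
      ((Complex.continuous_ofReal.comp hv').mul (continuous_const (y := Complex.I)))
    refine this.congr (fun q => ?_)
    apply Complex.ext <;> simp
  obtain ⟨q, hq⟩ := PM_global hF hab hcd
    (fun t ht => by simpa only [e1 a ca, e2 t ht] using hl t ht)
    (fun t ht => by simpa only [e1 b cb, e2 t ht] using hr t ht)
    (fun t ht => by simpa only [e1 t ht, e2 c cc] using hd t ht)
    (fun t ht => by simpa only [e1 t ht, e2 d cd] using hup t ht)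
  exact ⟨_, hm q, congrArg Complex.re hq, congrArg Complex.im hq⟩

end Tri
end

/-! ### Part 9 : consequences in the parameter plane (τ, s) -/

noncomputable section

namespace Tri

def Bt (τ : ℝ) : ℂ := ⟨Real.cos τ, Real.sin τ⟩

def Wt (q : ℝ × ℝ) : ℂ := (gB (Bt q.1) q.2)^[22] (-(Bt q.1)/2)

def oo (n : ℕ) (q : ℝ × ℝ) : ℂ × ℝ := orb (Bt q.1) q.2 (Wt q) n

/-- parameter box -/
def KK : Set (ℝ × ℝ) := {q | 0 ≤ Real.cos q.1 ∧ 0.548 ≤ Real.sin q.1 ∧ Real.sin q.1 ≤ 0.573 ∧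
  0 ≤ q.2 ∧ q.2 ≤ 1/10^11}

theorem KK_b {q : ℝ × ℝ} (hq : q ∈ KK) : 0.8195 ≤ Real.cos q.1 ∧ Real.cos q.1 ≤ 0.8365 := by
  obtain ⟨h0, h1, h2, -, -⟩ := hq
  have h := Real.sin_sq_add_cos_sq q.1
  constructor
  · by_contra hc
    push Not at hc
    nlinarith
  · by_contra hc
    push Not at hc
    nlinarith

theorem KK_sq (q : ℝ × ℝ) : Real.cos q.1 ^ 2 + Real.sin q.1 ^ 2 = 1 := Real.cos_sq_add_sin_sq q.1

theorem KK_W {q : ℝ × ℝ} (hq : q ∈ KK) :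
    -0.048 ≤ (Wt q).re ∧ (Wt q).re ≤ -0.046 ∧ -0.005 ≤ (Wt q).im ∧ (Wt q).im ≤ 0 ∧
    -1.605 ≤ eta q.2 (Wt q) ∧ eta q.2 (Wt q) ≤ -1.425 := by
  obtain ⟨W, hW, e1, e2, a1, a2, a3, a4, a5, a6, a7, a8, -⟩ :=
    box_fact hq.1 (KK_sq q) hq.2.1 hq.2.2.1 hq.2.2.2.1 hq.2.2.2.2
  have hW' : Wt q = W := hW
  rw [hW']
  exact ⟨a1, a2, a3, a4, a7.trans a5, a6.trans a8⟩

theorem KK_inv {q : ℝ × ℝ} (hq : q ∈ KK) (n : ℕ) : Inv (Bt q.1) q.2 (Wt q) n (oo n q) := by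
  obtain ⟨a1, a2, a3, a4, a5, a6⟩ := KK_W hq
  exact inv_all (KK_sq q) (KK_b hq).1 (KK_b hq).2 hq.2.1 hq.2.2.1 hq.2.2.2.1 hq.2.2.2.2 a1 a2 a3 a4 a5 a6 n

theorem cont_Bt : Continuous Bt := by
  have : Bt = fun τ : ℝ => (Real.cos τ : ℂ) + (Real.sin τ : ℂ) * Complex.I := by
    funext τ; apply Complex.ext <;> simp [Bt, -Complex.ofReal_cos, -Complex.ofReal_sin]
  rw [this]
  exact (Complex.continuous_ofReal.comp Real.continuous_cos).add
    ((Complex.continuous_ofReal.comp Real.continuous_sin).mul continuous_const)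

theorem cont_Wt : Continuous Wt := by
  have hB : Continuous fun q : ℝ × ℝ => Bt q.1 := cont_Bt.comp continuous_fst
  have hs : Continuous fun q : ℝ × ℝ => (q.2 : ℂ) := Complex.continuous_ofReal.comp continuous_snd
  have : ∀ n : ℕ, Continuous fun q : ℝ × ℝ => (gB (Bt q.1) q.2)^[n] (-(Bt q.1)/2) := by
    intro n
    induction n with
    | zero => exact hB.neg.div_const 2
    | succ k ih =>
      simp only [Function.iterate_succ_apply']
      have hc := Complex.continuous_conj.comp ih
      exact hc.add (hB.mul ((hc.pow 2).add hs))
  exact this 22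

theorem cont_oo (n : ℕ) : ContinuousOn (oo n) KK :=
  cont_orb (cont_Bt.comp continuous_fst).continuousOn continuous_snd.continuousOn cont_Wt.continuousOn
    (fun _ hq => hq.2.2.2.1) (fun _ hq m => KK_inv hq m) n

theorem KK_cases {q : ℝ × ℝ} (hq : q ∈ KK) (n : ℕ) :
    ((oo n q).1.re = 0.053) ∨ ((oo n q).2 = eta q.2 (oo n q).1 ∧
     DD q.2 (oo n q).1 ≤ 0.00287 ∧ |(oo n q).1.im| ≤ 0.0047 ∧
     (oo n q).1 = (ff (Bt q.1) q.2)^[n] (Wt q)) := by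
  rcases step_cases (KK_sq q) (KK_b hq).1 (KK_b hq).2 hq.2.1 hq.2.2.1 hq.2.2.2.2 (KK_W hq).1
    (KK_W hq).2.2.2.2.1 (KK_W hq).2.2.2.2.2 (KK_inv hq n) with
    ⟨h', -⟩ | ⟨j1, j2, j3, k1, k2, j5, -⟩
  · exact Or.inl h'
  · exact Or.inr ⟨j2, k1, k2, j5⟩

theorem ff_iter (B : ℂ) (s : ℝ) (n : ℕ) (w : ℂ) : (ff B s)^[n] w = (gB B s)^[2*n] w := by
  have : ff B s = (gB B s)^[2] := rfl
  rw [this, ← Function.iterate_mul]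

theorem separation {q : ℝ × ℝ} (hq : q ∈ KK) {n : ℕ} (h : (oo n q).1.re = 0.0497) :
    ∃ m, 2.8 < ‖2 * (gB (Bt q.1) q.2)^[m] (-(Bt q.1)/2) + Bt q.1‖ := by
  obtain ⟨W, hW, e1, e2, a1, a2, a3, a4, a5, a6, a7, a8, hesc⟩ :=
    box_fact hq.1 (KK_sq q) hq.2.1 hq.2.2.1 hq.2.2.2.1 hq.2.2.2.2
  have hW' : Wt q = W := hW
  rw [← hW'] at a1 a2 a3 a4 a5 a6
  obtain ⟨i1, i2, i3, -⟩ := KK_inv hq n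
  rcases KK_cases hq n with h' | ⟨j2, k1, k2, j5⟩
  · rw [h] at h'; norm_num at h'
  · have hw : (oo n q).1 = ⟨0.0497, (oo n q).1.im⟩ := Complex.ext h rfl
    rw [h] at i2 i3
    obtain ⟨m, hm⟩ := hesc (oo n q).1.im (k2.trans (by norm_num))
      (by rw [← hw, ← j2]; linarith only [i2, a1, a5]) (by rw [← hw, ← j2]; linarith only [i3, a1, a6])
    refine ⟨m + 2*n + 22, ?_⟩
    rw [Function.iterate_add_apply, Function.iterate_add_apply]
    rw [← hw, j5, ff_iter] at hm
    exact hm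

theorem bounded0 {q : ℝ × ℝ} (hq : q ∈ KK) (h0 : q.2 = 0) (n : ℕ) :
    (oo n q).1.re < 0 ∧ ‖(gB (Bt q.1) q.2)^[2*n+22] (-(Bt q.1)/2)‖ ≤ 1 := by
  obtain ⟨a1, a2, a3, a4, a5, a6⟩ := KK_W hq
  have hneg : (oo n q).1.re < 0 := by
    have hb := KK_b hq
    have := inv_neg (KK_sq q) hb.1 hb.2 hq.2.1 hq.2.2.1 a1 a2 a3 a4 (h0 ▸ a5) (h0 ▸ a6) n
    rw [oo, h0]; exact this
  refine ⟨hneg, ?_⟩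
  rcases KK_cases hq n with h' | ⟨j2, k1, k2, j5⟩
  · rw [h'] at hneg; norm_num at hneg
  · rw [Function.iterate_add_apply]
    rw [ff_iter] at j5
    have e : (gB (Bt q.1) q.2)^[2*n] ((gB (Bt q.1) q.2)^[22] (-(Bt q.1)/2)) = (oo n q).1 := j5.symm
    rw [e]
    have : ‖(oo n q).1‖^2 ≤ 1 := by
      rw [Complex.sq_norm, Complex.normSq_apply]
      rw [DD] at k1
      have := hq.2.2.2.1
      nlinarith only [k1, this]
    nlinarith [norm_nonneg (oo n q).1]

def τa : ℝ := Real.arcsin 0.55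
def τb : ℝ := Real.arcsin 0.571

theorem τ_mem {τ : ℝ} (h : τ ∈ Set.Icc τa τb) :
    0 < Real.cos τ ∧ 0.55 ≤ Real.sin τ ∧ Real.sin τ ≤ 0.571 := by
  have h1 : -(Real.pi/2) < τa := by
    unfold τa; rw [Real.neg_pi_div_two_lt_arcsin]; norm_num
  have h2 : τb < Real.pi/2 := by
    unfold τb; rw [Real.arcsin_lt_pi_div_two]; norm_num
  have sa : Real.sin τa = 0.55 := Real.sin_arcsin (by norm_num) (by norm_num)
  have sb : Real.sin τb = 0.571 := Real.sin_arcsin (by norm_num) (by norm_num)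
  have l1 := h.1
  have l2 := h.2
  refine ⟨Real.cos_pos_of_mem_Ioo ⟨by linarith, by linarith⟩, ?_, ?_⟩
  · rw [← sa]; exact Real.sin_le_sin_of_le_of_le_pi_div_two h1.le (by linarith) l1
  · rw [← sb]; exact Real.sin_le_sin_of_le_of_le_pi_div_two (by linarith) h2.le l2

theorem KK_of {τ s : ℝ} (h : τ ∈ Set.Icc τa τb) (hs0 : 0 ≤ s) (hs1 : s ≤ 1/10^11) : (τ, s) ∈ KK := by
  obtain ⟨h1, h2, h3⟩ := τ_mem h
  exact ⟨h1.le, by simp only; linarith, by simp only; linarith, hs0, hs1⟩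

theorem eta_inj {s : ℝ} {w t : ℂ} (hs : 0 ≤ s) (hre : w.re = t.re) (hx : 0.0505 ≤ t.re)
    (hw : |w.im| ≤ 0.0047) (ht1 : -0.009 ≤ t.im) (ht2 : t.im ≤ 0) (he : eta s w = eta s t) : w = t := by
  have p1 : 0 < DD s w := by rw [DD, hre]; positivity
  have p2 : 0 < DD s t := by rw [DD]; positivity
  rw [eta, eta, div_eq_div_iff p1.ne' p2.ne', DD, DD, hre] at he
  have hp := abs_le.mp (mulbd hw (abs_le.mpr ⟨ht1, by linarith only [ht2]⟩ : |t.im| ≤ 0.009))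
  have hf : (w.im - t.im) * (t.re^2 + s - w.im*t.im) = 0 := by linear_combination he
  have hA : t.re^2 + s - w.im*t.im ≠ 0 := by nlinarith only [hp.2, hx, hs]
  rcases mul_eq_zero.mp hf with h | h
  · exact Complex.ext hre (by linarith only [h])
  · exact absurd h hA

set_option maxHeartbeats 400000 in
theorem pm_app {s1 : ℝ} (hs0 : 0 < s1) (hs1 : s1 ≤ 1/10^11) :
    ∃ (n N : ℕ) (q : ℝ × ℝ), 0 < N ∧ q.1 ∈ Set.Icc τa τb ∧ 0 ≤ q.2 ∧ q.2 ≤ s1 ∧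
      0.0497 < (oo n q).1.re ∧ (gB (Bt q.1) q.2)^[N] (-(Bt q.1)/2) = -(Bt q.1)/2 := by
  obtain ⟨Z, hZ, hT⟩ := target_fact
  have hab : τa ≤ τb := Real.arcsin_le_arcsin (by norm_num)
  have hK : ∀ q ∈ Set.Icc τa τb ×ˢ Set.Icc 0 s1, q ∈ KK := fun q hq =>
    KK_of hq.1 hq.2.1 (hq.2.2.trans hs1)
  have hTT : ∀ q ∈ Set.Icc τa τb ×ˢ Set.Icc 0 s1, (Bt q.1, q.2) ∈ Z ∧
      0.0505 ≤ (tgt (Bt q.1) q.2).re ∧ (tgt (Bt q.1) q.2).re ≤ 0.0528 ∧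
      -0.009 ≤ (tgt (Bt q.1) q.2).im ∧ (tgt (Bt q.1) q.2).im ≤ 0 ∧
      (gB (Bt q.1) q.2)^[29] (tgt (Bt q.1) q.2) = -(Bt q.1)/2 := fun q hq =>
    hT _ _ _ (hK q hq).1 (KK_sq q) (τ_mem hq.1).2.1 (τ_mem hq.1).2.2 hq.2.1 (hq.2.2.trans hs1)
  obtain ⟨n, hn⟩ := exists_nat_gt (0.101 / (1.4 * s1))
  rw [div_lt_iff₀ (by positivity)] at hn
  have hS : ContinuousOn (fun q : ℝ × ℝ => q.2) (Set.Icc τa τb ×ˢ Set.Icc 0 s1) := continuous_snd.continuousOn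
  have ho : ContinuousOn (oo n) (Set.Icc τa τb ×ˢ Set.Icc 0 s1) := (cont_oo n).mono hK
  have hw : ContinuousOn (fun q => (oo n q).1) (Set.Icc τa τb ×ˢ Set.Icc 0 s1) :=
    continuous_fst.comp_continuousOn ho
  have hh : ContinuousOn (fun q => (oo n q).2) (Set.Icc τa τb ×ˢ Set.Icc 0 s1) :=
    continuous_snd.comp_continuousOn ho
  have ht : ContinuousOn (fun q : ℝ × ℝ => tgt (Bt q.1) q.2) (Set.Icc τa τb ×ˢ Set.Icc 0 s1) :=
    ContinuousOn.comp (g := fun q : ℂ × ℝ => tgt q.1 q.2) (f := fun q : ℝ × ℝ => (Bt q.1, q.2)) hZ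
      ((cont_Bt.comp continuous_fst).prodMk continuous_snd).continuousOn (fun q hq => (hTT q hq).1)
  have htη := cont_eta hS ht (fun q hq => by
    have h1 := (hTT q hq).2.1
    have h2 := hq.2.1
    rw [DD]; positivity)
  have htr := Complex.continuous_re.comp_continuousOn ht
  have hwr := Complex.continuous_re.comp_continuousOn hw
  have sa : Real.sin τa = 0.55 := Real.sin_arcsin (by norm_num) (by norm_num)
  have sb : Real.sin τb = 0.571 := Real.sin_arcsin (by norm_num) (by norm_num)
  have ca : τa ∈ Set.Icc τa τb := ⟨le_rfl, hab⟩
  have cb : τb ∈ Set.Icc τa τb := ⟨hab, le_rfl⟩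
  have c0 : (0:ℝ) ∈ Set.Icc 0 s1 := ⟨le_rfl, hs0.le⟩
  have c1 : s1 ∈ Set.Icc 0 s1 := ⟨hs0.le, le_rfl⟩
  have xle : ∀ q ∈ KK, (oo n q).1.re ≤ 0.053 := fun q hq => by
    rcases (KK_inv hq n).2.2.2 with h | h
    · exact h.le
    · exact h.1.le
  obtain ⟨q, hq, hu, hv⟩ := PM (u := fun q => (oo n q).2 - eta q.2 (tgt (Bt q.1) q.2))
    (v := fun q => (oo n q).1.re - (tgt (Bt q.1) q.2).re) hab hs0.le (hh.sub htη) (hwr.sub htr)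
    (by
      intro t ht
      have hk := hK (τa, t) ⟨ca, ht⟩
      have h1 := (KK_inv hk n).2.1
      have h2 := xle _ hk
      have h3 := (KK_W hk).1
      have hsq := KK_sq (τa, t)
      have h4 := hk.1
      simp only at hsq h4
      rw [sa] at hsq
      have h5 := W_A h4 hsq ht.1 (ht.2.trans hs1)
      have h6 := tgt_A h4 hsq ht.1 (ht.2.trans hs1)
      have hB : Bt τa = ⟨Real.cos τa, 0.55⟩ := by rw [Bt, sa]
      rw [← hB] at h5 h6
      have h7 : -1.46 ≤ eta t (Wt (τa, t)) := h5
      simp only at h1 h2 h3 ⊢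
      linarith only [h1, h2, h3, h7, h6])
    (by
      intro t ht
      have hk := hK (τb, t) ⟨cb, ht⟩
      have h1 := (KK_inv hk n).2.2.1
      have h2 := xle _ hk
      have h3 := (KK_W hk).1
      have hsq := KK_sq (τb, t)
      have h4 := hk.1
      simp only at hsq h4
      rw [sb] at hsq
      have h5 := W_B h4 hsq ht.1 (ht.2.trans hs1)
      have h6 := tgt_B h4 hsq ht.1 (ht.2.trans hs1)
      have hB : Bt τb = ⟨Real.cos τb, 0.571⟩ := by rw [Bt, sb]
      rw [← hB] at h5 h6
      have h7 : eta t (Wt (τb, t)) ≤ -1.555 := h5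
      simp only at h1 h2 h3 ⊢
      linarith only [h1, h2, h3, h7, h6])
    (by
      intro t ht
      have h1 := (bounded0 (hK (t, 0) ⟨ht, c0⟩) rfl n).1
      have h2 := (hTT (t, 0) ⟨ht, c0⟩).2.1
      simp only at h1 h2 ⊢
      linarith only [h1, h2])
    (by
      intro t ht
      have hk := hK (t, s1) ⟨ht, c1⟩
      have h1 := inv_end (KK_W hk).1 (by simp only; linarith only [hn]) (KK_inv hk n)
      have h2 := (hTT (t, s1) ⟨ht, c1⟩).2.2.1
      simp only at h1 h2 ⊢
      linarith only [h1, h2])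
  obtain ⟨-, t1, t2, t3, t4, t5⟩ := hTT q hq
  have hre : (oo n q).1.re = (tgt (Bt q.1) q.2).re := by linarith only [hv]
  refine ⟨n, 29 + (2*n + 22), q, by omega, hq.1, hq.2.1, hq.2.2, by linarith only [hre, t1], ?_⟩
  rcases KK_cases (hK q hq) n with h' | ⟨j2, k1, k2, j5⟩
  · linarith only [h', hre, t2]
  · have hw := eta_inj hq.2.1 hre t1 k2 t3 t4 (by linarith only [hu, j2])
    rw [Function.iterate_add_apply, Function.iterate_add_apply]
    rw [ff_iter] at j5
    have e : (gB (Bt q.1) q.2)^[2*n] ((gB (Bt q.1) q.2)^[22] (-(Bt q.1)/2)) = (oo n q).1 := j5.symm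
    rw [e, hw, t5]

end Tri
end

/-! ### Part 10 : parametrization and conclusion -/

noncomputable section

namespace Tri

open Complex in
def lam (τ : ℝ) : ℂ := exp (((-(τ/3) : ℝ) : ℂ) * I)

open Complex in
def cc (q : ℝ × ℝ) : ℂ :=
  exp (((2*q.1/3 : ℝ) : ℂ) * I) * (1/2 + (q.2 : ℂ)) - exp (((-(4*q.1/3) : ℝ) : ℂ) * I) / 4

theorem Bt_exp (τ : ℝ) : Bt τ = Complex.exp ((τ : ℂ) * Complex.I) := by
  apply Complex.ext
  · rw [Complex.exp_ofReal_mul_I_re]; rfl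
  · rw [Complex.exp_ofReal_mul_I_im]; rfl

theorem conj_exp (t : ℝ) : starRingEnd ℂ (Complex.exp ((t : ℂ) * Complex.I)) =
    Complex.exp (((-t : ℝ) : ℂ) * Complex.I) := by
  rw [← Complex.exp_conj]; simp

theorem exp_mul (t u : ℝ) : Complex.exp ((t : ℂ) * Complex.I) * Complex.exp ((u : ℂ) * Complex.I) =
    Complex.exp (((t + u : ℝ) : ℂ) * Complex.I) := by
  rw [← Complex.exp_add]; push_cast; ring_nf

theorem lam_norm (τ : ℝ) : ‖lam τ‖ = 1 := Complex.norm_exp_ofReal_mul_I _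

theorem Bt_norm (τ : ℝ) : ‖Bt τ‖ = 1 := by rw [Bt_exp]; exact Complex.norm_exp_ofReal_mul_I _

theorem lam_conj (τ : ℝ) : (starRingEnd ℂ (lam τ))^2 = lam τ * Bt τ := by
  rw [lam, conj_exp, Bt_exp, exp_mul, sq, exp_mul]; congr 3; ring

theorem cc_eq (q : ℝ × ℝ) : cc q = lam q.1 * Bt q.1 * (1/2 + (q.2:ℂ)) - lam q.1 * starRingEnd ℂ (Bt q.1) / 4 := by
  rw [cc, lam, Bt_exp, conj_exp, exp_mul, exp_mul]
  congr 5 <;> ring_nf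

def AA (c : ℂ) : ℂ → ℂ := fun z => (starRingEnd ℂ z) ^ 2 + c

theorem AA_conj (q : ℝ × ℝ) (w : ℂ) :
    AA (cc q) (lam q.1 * (w + Bt q.1 / 2)) = lam q.1 * (gB (Bt q.1) q.2 w + Bt q.1 / 2) := by
  have h1 := lam_conj q.1
  have h2 := mul_conj_one (Bt_norm q.1)
  rw [cc_eq]
  simp only [AA, gB, map_mul, map_add, map_div₀, map_ofNat]
  rw [mul_pow, h1]
  linear_combination (lam q.1 * starRingEnd ℂ w + lam q.1 * starRingEnd ℂ (Bt q.1) / 4) * h2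

theorem AA_iter (q : ℝ × ℝ) (n : ℕ) :
    (AA (cc q))^[n] 0 = lam q.1 * ((gB (Bt q.1) q.2)^[n] (-(Bt q.1)/2) + Bt q.1 / 2) := by
  induction n with
  | zero => simp only [Function.iterate_zero, id]; ring
  | succ k ih => rw [Function.iterate_succ_apply', ih, AA_conj, Function.iterate_succ_apply']

def TT : Set ℂ := {c : ℂ | Bornology.IsBounded (Set.range fun n : ℕ => (AA c)^[n] 0)}

theorem TT_periodic {q : ℝ × ℝ} {N : ℕ} (hN : 0 < N)
    (h : (gB (Bt q.1) q.2)^[N] (-(Bt q.1)/2) = -(Bt q.1)/2) : cc q ∈ TT := by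
  have hp : Function.IsPeriodicPt (AA (cc q)) N 0 := by
    rw [Function.IsPeriodicPt, Function.IsFixedPt, AA_iter, h]; ring
  have hfin : (Set.range fun n : ℕ => (AA (cc q))^[n] 0).Finite := by
    refine ((Set.finite_lt_nat N).image (fun n => (AA (cc q))^[n] 0)).subset ?_
    rintro _ ⟨n, rfl⟩
    exact ⟨n % N, Nat.mod_lt _ hN, hp.iterate_mod_apply n⟩
  exact hfin.isBounded

theorem gB_norm {B : ℂ} (hB : ‖B‖ = 1) {s : ℝ} (hs : |s| ≤ 1) {w : ℂ} (hw : ‖w‖ ≤ 1) : ‖gB B s w‖ ≤ 3 := by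
  have hc : ‖starRingEnd ℂ w‖ ≤ 1 := by rw [Complex.norm_conj]; exact hw
  have h1 : ‖(starRingEnd ℂ w)^2‖ ≤ 1 := by rw [norm_pow]; exact pow_le_one₀ (norm_nonneg _) hc
  have h2 : ‖(s:ℂ)‖ ≤ 1 := by rw [Complex.norm_real]; exact hs
  calc ‖gB B s w‖ ≤ ‖starRingEnd ℂ w‖ + ‖B * ((starRingEnd ℂ w)^2 + s)‖ := norm_add_le _ _
    _ ≤ 1 + 1 * (1 + 1) := by
      rw [norm_mul, hB]
      have := norm_add_le ((starRingEnd ℂ w)^2) (s:ℂ)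
      linarith
    _ = 3 := by norm_num

theorem TT_zero {q : ℝ × ℝ} (hq : q ∈ KK) (h0 : q.2 = 0) : cc q ∈ TT := by
  have hb : ∀ n : ℕ, ‖(gB (Bt q.1) q.2)^[n+22] (-(Bt q.1)/2)‖ ≤ 3 := by
    intro n
    rcases Nat.even_or_odd' n with ⟨k, rfl | rfl⟩
    · exact ((bounded0 hq h0 k).2).trans (by norm_num)
    · rw [show 2*k+1+22 = (2*k+22)+1 by ring, Function.iterate_succ_apply']
      exact gB_norm (Bt_norm _) (by rw [h0]; simp) (bounded0 hq h0 k).2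
  have h2 : ∀ n : ℕ, ‖(AA (cc q))^[n+22] 0‖ ≤ 4 := by
    intro n
    rw [AA_iter, norm_mul, lam_norm, one_mul]
    refine (norm_add_le _ _).trans ?_
    have h3 : ‖Bt q.1 / 2‖ ≤ 1 := by rw [norm_div, Bt_norm]; norm_num
    linarith [hb n]
  have h1 : ((fun n => (AA (cc q))^[n] 0) '' {n | n < 22}).Finite := (Set.finite_lt_nat 22).image _
  refine (h1.isBounded.union (Metric.isBounded_closedBall (x := (0:ℂ)) (r := 4))).subset ?_
  rintro _ ⟨n, rfl⟩
  rcases lt_or_ge n 22 with h | h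
  · exact Or.inl ⟨n, h, rfl⟩
  · right
    obtain ⟨k, rfl⟩ := Nat.exists_eq_add_of_le' h
    rw [mem_closedBall_zero_iff]
    exact h2 k

theorem cc_norm {q : ℝ × ℝ} (hq : q ∈ KK) : ‖cc q‖ ≤ 0.5 := by
  have h2 := mul_conj_one (Bt_norm q.1)
  have e : cc q = lam q.1 * (Bt q.1 * (1/2 + (q.2:ℂ)) - starRingEnd ℂ (Bt q.1) / 4) := by
    rw [cc_eq]; ring
  rw [e, norm_mul, lam_norm, one_mul]
  obtain ⟨h0, h1, h2, h3, h4⟩ := hq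
  have hs := Real.sin_sq_add_cos_sq q.1
  have hn : ‖Bt q.1 * (1/2 + (q.2:ℂ)) - starRingEnd ℂ (Bt q.1) / 4‖^2 =
      (Real.cos q.1 * (1/4 + q.2))^2 + (Real.sin q.1 * (3/4 + q.2))^2 := by
    rw [show (1/2 + (q.2:ℂ)) = ((1/2 + q.2 : ℝ) : ℂ) by push_cast; ring,
      show starRingEnd ℂ (Bt q.1) / 4 = starRingEnd ℂ (Bt q.1) * ((1/4 : ℝ) : ℂ) by push_cast; ring,
      Complex.sq_norm, Complex.normSq_apply]
    simp only [Complex.sub_re, Complex.sub_im, Complex.mul_re, Complex.mul_im, Complex.ofReal_re,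
      Complex.ofReal_im, Complex.conj_re, Complex.conj_im, Bt]
    ring
  have hsin : Real.sin q.1 ^ 2 ≤ 0.573^2 := pow_le_pow_left₀ (by linarith) h2 2
  have hA : (1/4 + q.2)^2 ≤ 0.2501^2 := pow_le_pow_left₀ (by linarith) (by norm_num at h4 ⊢; linarith) 2
  have hB : (3/4 + q.2)^2 ≤ 0.7501^2 := pow_le_pow_left₀ (by linarith) (by norm_num at h4 ⊢; linarith) 2
  have hk : ‖Bt q.1 * (1/2 + (q.2:ℂ)) - starRingEnd ℂ (Bt q.1) / 4‖^2 ≤ 0.5^2 := by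
    rw [hn, mul_pow, mul_pow]
    have m1 : Real.cos q.1 ^ 2 * (1/4 + q.2)^2 ≤ Real.cos q.1 ^ 2 * 0.2501^2 :=
      mul_le_mul_of_nonneg_left hA (sq_nonneg _)
    have m2 : Real.sin q.1 ^ 2 * (3/4 + q.2)^2 ≤ Real.sin q.1 ^ 2 * 0.7501^2 :=
      mul_le_mul_of_nonneg_left hB (sq_nonneg _)
    linarith only [m1, m2, hsin, hs]
  exact (sq_le_sq₀ (norm_nonneg _) (by norm_num)).mp hk

theorem AA_escape {c : ℂ} (hc : ‖c‖ ≤ 0.5) {m : ℕ} (h : 1.4 ≤ ‖(AA c)^[m] 0‖) : c ∉ TT := by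
  have key : ∀ n : ℕ, 1.4 + 0.06 * (n:ℝ) ≤ ‖(AA c)^[m+n] 0‖ := by
    intro n
    induction n with
    | zero => simpa using h
    | succ k ih =>
      rw [← add_assoc, Function.iterate_succ_apply']
      set z := (AA c)^[m+k] 0
      have h1 : ‖AA c z‖ ≥ ‖z‖^2 - ‖c‖ := by
        have := norm_sub_le_norm_add ((starRingEnd ℂ z)^2) c
        rw [norm_pow, Complex.norm_conj] at this
        exact this
      have hk : (0:ℝ) ≤ k := Nat.cast_nonneg k
      push_cast
      nlinarith
  intro hT
  have hT2 : Bornology.IsBounded (Set.range fun n : ℕ => (AA c)^[n] 0) := hT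
  obtain ⟨R, hR⟩ := isBounded_iff_forall_norm_le.mp hT2
  obtain ⟨n, hn⟩ := exists_nat_gt (R / 0.06)
  rw [div_lt_iff₀ (by norm_num)] at hn
  have h1 := hR _ ⟨m+n, rfl⟩
  have h2 := key n
  simp only at h1
  linarith

theorem sep_TT {q : ℝ × ℝ} (hq : q ∈ KK) (hT : cc q ∈ TT) (n : ℕ) : (oo n q).1.re ≠ 0.0497 := by
  intro h
  obtain ⟨m, hm⟩ := separation hq h
  refine AA_escape (cc_norm hq) (m := m) ?_ hT
  rw [AA_iter, norm_mul, lam_norm, one_mul]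
  have e : 2 * (gB (Bt q.1) q.2)^[m] (-(Bt q.1)/2) + Bt q.1 =
    2 * ((gB (Bt q.1) q.2)^[m] (-(Bt q.1)/2) + Bt q.1 / 2) := by ring
  rw [e, norm_mul] at hm
  simp only [Complex.norm_ofNat] at hm
  linarith

/-- derivative -/
def dτ (q : ℝ × ℝ) : ℂ := Complex.exp (((2*q.1/3 : ℝ) : ℂ) * Complex.I) * ((2/3 : ℂ) * Complex.I) * (1/2 + (q.2 : ℂ))
  + Complex.exp (((-(4*q.1/3) : ℝ) : ℂ) * Complex.I) * (1/3 * Complex.I)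

def dL (q : ℝ × ℝ) : ℝ × ℝ →L[ℝ] ℂ :=
  (ContinuousLinearMap.fst ℝ ℝ ℝ).smulRight (dτ q) +
  (ContinuousLinearMap.snd ℝ ℝ ℝ).smulRight (Complex.exp (((2*q.1/3 : ℝ) : ℂ) * Complex.I))

theorem cc_deriv (q : ℝ × ℝ) : HasStrictFDerivAt cc (dL q) q := by
  have hof : ∀ x : ℝ, HasStrictDerivAt (fun y : ℝ => (y : ℂ)) 1 x := fun x =>
    Complex.ofRealCLM.hasStrictDerivAt
  have h1 : HasStrictDerivAt (fun t : ℝ => Complex.exp (((2*t/3 : ℝ) : ℂ) * Complex.I))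
      (Complex.exp (((2*q.1/3 : ℝ) : ℂ) * Complex.I) * ((2/3 : ℂ) * Complex.I)) q.1 := by
    have h := (((hof q.1).const_mul (2/3 : ℂ)).mul_const Complex.I).cexp
    convert h using 2
    · push_cast; ring_nf
    · push_cast; ring_nf
    · ring
  have h2 : HasStrictDerivAt (fun t : ℝ => Complex.exp (((-(4*t/3) : ℝ) : ℂ) * Complex.I))
      (Complex.exp (((-(4*q.1/3) : ℝ) : ℂ) * Complex.I) * ((-4/3 : ℂ) * Complex.I)) q.1 := by
    have h := (((hof q.1).const_mul (-4/3 : ℂ)).mul_const Complex.I).cexp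
    convert h using 2
    · push_cast; ring_nf
    · push_cast; ring_nf
    · ring
  have h3 : HasStrictDerivAt (fun t : ℝ => (1/2 : ℂ) + (t:ℂ)) 1 q.2 := (hof q.2).const_add _
  have g1 := h1.hasStrictFDerivAt.comp q (hasStrictFDerivAt_fst (𝕜 := ℝ) (E := ℝ) (F := ℝ))
  have g2 := h2.hasStrictFDerivAt.comp q (hasStrictFDerivAt_fst (𝕜 := ℝ) (E := ℝ) (F := ℝ))
  have g3 := h3.hasStrictFDerivAt.comp q (hasStrictFDerivAt_snd (𝕜 := ℝ) (E := ℝ) (F := ℝ))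
  have g := (g1.mul g3).sub (g2.mul_const (1/4 : ℂ))
  refine (g.congr_fderiv ?_).congr_of_eventuallyEq (Filter.Eventually.of_forall fun x => ?_)
  · ext
    · simp [dL, dτ]; ring
    · simp [dL, dτ]
  · simp [cc]; ring

theorem dL_inj {q : ℝ × ℝ} (h0 : 0 < Real.cos q.1) (hs : q.2 = 0) : Function.Injective (dL q) := by
  rw [injective_iff_map_eq_zero]
  rintro ⟨u, v⟩ h
  have hne := Complex.exp_ne_zero (((2*q.1/3 : ℝ) : ℂ) * Complex.I)
  have e : Complex.exp (((-(4*q.1/3) : ℝ) : ℂ) * Complex.I) =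
      Complex.exp (((2*q.1/3 : ℝ) : ℂ) * Complex.I) * starRingEnd ℂ (Bt (2*q.1)) := by
    rw [Bt_exp, conj_exp, exp_mul]; congr 3; ring
  have h1 : Complex.exp (((2*q.1/3 : ℝ) : ℂ) * Complex.I) *
      ((u : ℂ) * (Complex.I * ((1/3 : ℝ) : ℂ) * (1 + starRingEnd ℂ (Bt (2*q.1)))) + (v : ℂ)) = 0 := by
    rw [← h]
    simp only [dL, dτ, e, hs]
    simp
    ring
  have h2 := (mul_eq_zero.mp h1).resolve_left hne
  have hi := congrArg Complex.im h2
  have hr := congrArg Complex.re h2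
  simp only [Bt, Complex.add_im, Complex.mul_im, Complex.mul_re, Complex.add_re, Complex.ofReal_re,
    Complex.ofReal_im, Complex.I_re, Complex.I_im, Complex.conj_re, Complex.conj_im, Complex.one_re,
    Complex.one_im, Complex.zero_re, Complex.zero_im] at hi hr
  have hc : Real.cos (2*q.1) = 2 * Real.cos q.1 ^ 2 - 1 := Real.cos_two_mul _
  have hu : u = 0 := by
    have : u * (Real.cos q.1 ^ 2) = 0 := by rw [hc] at hi; linarith
    exact (mul_eq_zero.mp this).resolve_right (by positivity)
  rw [hu] at hr
  have hv : v = 0 := by linarith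
  rw [hu, hv]; rfl

theorem exists_local {q : ℝ × ℝ} (h0 : 0 < Real.cos q.1) (hs : q.2 = 0) :
    ∃ e : OpenPartialHomeomorph (ℝ × ℝ) ℂ, q ∈ e.source ∧ ∀ x, e x = cc x := by
  have hfr : Module.finrank ℝ (ℝ × ℝ) = Module.finrank ℝ ℂ := by
    rw [Complex.finrank_real_complex]; simp
  let E : (ℝ × ℝ) ≃L[ℝ] ℂ :=
    (LinearMap.linearEquivOfInjective (dL q : ℝ × ℝ →ₗ[ℝ] ℂ) (dL_inj h0 hs) hfr).toContinuousLinearEquiv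
  have hE : (E : ℝ × ℝ →L[ℝ] ℂ) = dL q := by
    ext <;> rfl
  have hd : HasStrictFDerivAt cc (E : ℝ × ℝ →L[ℝ] ℂ) q := hE ▸ cc_deriv q
  exact ⟨hd.toOpenPartialHomeomorph cc, hd.mem_toOpenPartialHomeomorph_source, fun x => by
    rw [hd.toOpenPartialHomeomorph_coe]⟩

theorem TT_not_lc : ¬ LocallyConnectedSpace TT := by
  intro hLC
  have hpm : ∀ k : ℕ, ∃ (n N : ℕ) (q : ℝ × ℝ), 0 < N ∧ q.1 ∈ Set.Icc τa τb ∧ 0 ≤ q.2 ∧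
      q.2 ≤ (1/10^11) * (1/((k:ℝ)+1)) ∧
      0.0497 < (oo n q).1.re ∧ (gB (Bt q.1) q.2)^[N] (-(Bt q.1)/2) = -(Bt q.1)/2 := fun k => by
    refine pm_app (by positivity) ?_
    have : (1:ℝ)/((k:ℝ)+1) ≤ 1 := by
      rw [div_le_one (by positivity)]; linarith [(Nat.cast_nonneg k : (0:ℝ) ≤ k)]
    calc (1/10^11 : ℝ) * (1/((k:ℝ)+1)) ≤ (1/10^11) * 1 := mul_le_mul_of_nonneg_left this (by norm_num)
      _ = _ := mul_one _
  choose n N q hN hτ hs0 hs1 hgt hper using hpm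
  obtain ⟨τ0, hτ0, φ, hφ, hlim⟩ := isCompact_Icc.tendsto_subseq (fun k => hτ k)
  have hslim : Filter.Tendsto (fun k => (q (φ k)).2) Filter.atTop (nhds 0) := by
    have h1 : Filter.Tendsto (fun k => (q k).2) Filter.atTop (nhds 0) := by
      refine squeeze_zero hs0 hs1 ?_
      have := (tendsto_one_div_add_atTop_nhds_zero_nat (𝕜 := ℝ)).const_mul (1/10^11 : ℝ)
      rwa [mul_zero] at this
    exact h1.comp hφ.tendsto_atTop
  have hqlim : Filter.Tendsto (fun k => q (φ k)) Filter.atTop (nhds (τ0, 0)) := by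
    rw [nhds_prod_eq]; exact hlim.prodMk hslim
  obtain ⟨c1, c2, c3⟩ := τ_mem hτ0
  obtain ⟨e, he, hee⟩ := exists_local (q := (τ0, 0)) c1 rfl
  -- open neighbourhood in the parameter plane
  let O : Set (ℝ × ℝ) := e.source ∩ {x | 0 < Real.cos x.1 ∧ 0.548 < Real.sin x.1 ∧ Real.sin x.1 < 0.573 ∧ x.2 < 1/10^11}
  have hO : IsOpen O := by
    refine e.open_source.inter ?_
    have hcos : Continuous fun x : ℝ × ℝ => Real.cos x.1 := Real.continuous_cos.comp continuous_fst
    have hsin : Continuous fun x : ℝ × ℝ => Real.sin x.1 := Real.continuous_sin.comp continuous_fst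
    exact (isOpen_lt continuous_const hcos).inter ((isOpen_lt continuous_const hsin).inter
      ((isOpen_lt hsin continuous_const).inter (isOpen_lt continuous_snd continuous_const)))
  have hO0 : ((τ0, 0) : ℝ × ℝ) ∈ O := ⟨he, c1, by simp only; linarith, by simp only; linarith, by norm_num⟩
  have hOs : O ⊆ e.source := Set.inter_subset_left
  have hU : IsOpen (e '' O) := e.isOpen_image_of_subset_source hO hOs
  have hc0 : cc (τ0, 0) ∈ TT := TT_zero (KK_of hτ0 le_rfl (by norm_num)) rfl
  have hck : ∀ k, cc (q k) ∈ TT := fun k => TT_periodic (hN k) (hper k)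
  have hUT : ((↑) ⁻¹' (e '' O) : Set TT) ∈ nhds (⟨cc (τ0, 0), hc0⟩ : TT) := by
    refine (hU.preimage continuous_subtype_val).mem_nhds ?_
    exact ⟨_, hO0, hee _⟩
  obtain ⟨V, hVU, hVo, hV0, hVc⟩ := locallyConnectedSpace_iff_subsets_isOpen_isConnected.mp hLC _ _ hUT
  have hcc : Continuous cc := continuous_iff_continuousAt.mpr fun x => (cc_deriv x).hasFDerivAt.continuousAt
  have hlimT : Filter.Tendsto (fun k => (⟨cc (q (φ k)), hck _⟩ : TT)) Filter.atTop (nhds ⟨cc (τ0, 0), hc0⟩) := by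
    rw [tendsto_subtype_rng]
    exact (hcc.tendsto _).comp hqlim
  obtain ⟨k, hkV, hkO⟩ := ((hlimT.eventually (hVo.mem_nhds hV0)).and (hqlim.eventually (hO.mem_nhds hO0))).exists
  -- the separating function
  let ψ : TT → ℝ × ℝ := fun c => ((e.symm c.1).1, max (e.symm c.1).2 0)
  have hψK : ∀ c ∈ V, ψ c ∈ KK := by
    intro c hc
    obtain ⟨x, hx, hxe⟩ := hVU hc
    have : e.symm c.1 = x := by rw [← hxe]; exact e.left_inv (hOs hx)
    simp only [ψ, this]
    obtain ⟨-, x1, x2, x3, x4⟩ := hx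
    exact ⟨x1.le, x2.le, x3.le, le_max_right _ _, max_le x4.le (by norm_num)⟩
  have hsymm : ContinuousOn (fun c : TT => e.symm c.1) V := by
    refine e.continuousOn_symm.comp continuous_subtype_val.continuousOn ?_
    intro c hc
    obtain ⟨x, hx, hxe⟩ := hVU hc
    have : e x ∈ e.target := e.map_source (hOs hx)
    rwa [hxe] at this
  have hψc : ContinuousOn ψ V :=
    (continuous_fst.comp_continuousOn hsymm).prodMk
      ((continuous_snd.comp_continuousOn hsymm).sup continuousOn_const)
  have hfun : ContinuousOn (fun c => (oo (n (φ k)) (ψ c)).1.re) V :=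
    Complex.continuous_re.comp_continuousOn
      (continuous_fst.comp_continuousOn ((cont_oo (n (φ k))).comp hψc hψK))
  have hne : ∀ c ∈ V, (oo (n (φ k)) (ψ c)).1.re ≠ 0.0497 := by
    intro c hc
    obtain ⟨x, hx, hxe⟩ := hVU hc
    have hex : e.symm c.1 = x := by rw [← hxe]; exact e.left_inv (hOs hx)
    rcases le_total 0 x.2 with h | h
    · refine sep_TT (hψK c hc) ?_ _
      have : ψ c = x := by
        simp only [ψ, hex, max_eq_left h]
      rw [this, ← hee, hxe]
      exact c.2
    · have h0 : (ψ c).2 = 0 := by simp only [ψ, hex, max_eq_right h]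
      have := (bounded0 (hψK c hc) h0 (n (φ k))).1
      intro hcon
      rw [hcon] at this
      norm_num at this
  have hleft : (oo (n (φ k)) (ψ ⟨cc (τ0, 0), hc0⟩)).1.re < 0 := by
    refine (bounded0 (hψK _ hV0) ?_ _).1
    have : e.symm (cc (τ0, 0)) = (τ0, 0) := by rw [← hee]; exact e.left_inv he
    simp only [ψ, this, max_self]
  have hright : 0.0497 < (oo (n (φ k)) (ψ ⟨cc (q (φ k)), hck _⟩)).1.re := by
    have : e.symm (cc (q (φ k))) = q (φ k) := by rw [← hee]; exact e.left_inv (hOs hkO)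
    have h2 : ψ ⟨cc (q (φ k)), hck _⟩ = q (φ k) := by
      simp only [ψ, this, max_eq_left (hs0 (φ k))]
    rw [h2]; exact hgt _
  obtain ⟨c, hc, hce⟩ := hVc.isPreconnected.intermediate_value hV0 hkV hfun
    (show (0.0497 : ℝ) ∈ Set.Icc _ _ from ⟨by linarith, hright.le⟩)
  exact hne c hc hce

end Tri
end

/-- The tricorn, the connectedness locus of the anti-holomorphic family
`A_c(z) = z̄² + c`, is not locally connected. -/
theorem tricorn_not_locally_connected :
    ¬ LocallyConnectedSpace
      ({c : ℂ | Bornology.IsBounded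
        (Set.range fun n : ℕ =>
          (fun z : ℂ => (starRingEnd ℂ z) ^ 2 + c)^[n] 0)} : Set ℂ) := by
  exact Tri.TT_not_lc
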